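/- arXiv:1603.03571 — 2 statements merged into one kernel-verified Lean document; each statement's English description precedes it below -/
import Mathlib

section
/- (Theorem 3: vanishing probability of no idle flexible servers.) Under the setup below, with ρ < 1, δ < 1 and α + β > 1, lim_{n→∞} P_n({(k,i₁,i₂) : i₁ = 0}) = 0. -/
open Filter

/-- Number of pool-1 (flexible) servers for system size `n`. -/
noncomputable def Npool1 (θ : ℝ) (n : ℕ) : ℕ := ⌈θ * n⌉₊

/-- Number of pool-2 servers for system size `n`. -/
noncomputable def Npool2 (θ : ℝ) (n : ℕ) : ℕ := n - Npool1 θ n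

/-- Total arrival rate for system size `n`. -/
noncomputable def Nlam (μ₁ μ₂ θ ρ : ℝ) (n : ℕ) : ℝ :=
  ρ * ((Npool1 θ n : ℝ) * μ₁ + (Npool2 θ n : ℝ) * μ₂)

/-- Unnormalized stationary weight `w_n(k, i₁, i₂)` of the FCFS-ALIS
many-server N-system, where `k` is the number of pool-2 servers following the
last pool-1 server among the idle servers and `i₁`, `i₂` are the numbers of
idle pool-1, pool-2 servers. -/
noncomputable def Nwt (μ₁ μ₂ θ ρ α : ℝ) (n : ℕ) : ℕ × ℕ × ℕ → ℝ := fun t =>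
  let k := t.1
  let i₁ := t.2.1
  let i₂ := t.2.2
  let n₁ := Npool1 θ n
  let n₂ := Npool2 θ n
  let lam := Nlam μ₁ μ₂ θ ρ n
  let lam₁ := α * lam
  let lam₂ := (1 - α) * lam
  if k ≤ n₂ ∧ 1 ≤ i₁ ∧ i₁ ≤ n₁ ∧ k ≤ i₂ ∧ i₂ ≤ n₂ then
    (n₁.choose i₁ : ℝ) * (n₂.choose i₂ : ℝ) * (i₁ : ℝ) *
      ((i₁ + i₂ - k - 1).factorial : ℝ) * ((i₂.factorial : ℝ) / ((i₂ - k).factorial : ℝ)) *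
      μ₁ ^ i₁ * μ₂ ^ i₂ * (lam ^ (i₁ + i₂))⁻¹ * (lam / lam₁) ^ k
  else if 1 ≤ k ∧ k ≤ n₂ ∧ i₁ = 0 ∧ 1 ≤ i₂ ∧ i₂ ≤ k then
    (n₁ : ℝ) * ((n₂.factorial : ℝ) / ((n₂ - k).factorial : ℝ)) * μ₁ * μ₂ ^ k *
      (lam₁ ^ i₂)⁻¹ *
      ∏ j ∈ Finset.Icc (n - k) (n - i₂), (μ₁ * (n₁ : ℝ) + μ₂ * ((j : ℝ) - (n₁ : ℝ)) - lam₂)⁻¹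
  else if k ≤ n₂ ∧ i₁ = 0 ∧ i₂ = 0 then
    (n₁ : ℝ) * ((n₂.factorial : ℝ) / ((n₂ - k).factorial : ℝ)) * μ₁ * μ₂ ^ k *
      (μ₁ * (n₁ : ℝ) + μ₂ * (n₂ : ℝ) - lam)⁻¹ *
      ∏ j ∈ Finset.Icc (n - k) (n - 1), (μ₁ * (n₁ : ℝ) + μ₂ * ((j : ℝ) - (n₁ : ℝ)) - lam₂)⁻¹
  else 0

/-- Stationary probability of the event `E` of triples `(k, i₁, i₂)` for the
FCFS-ALIS many-server N-system of size `n`. -/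
noncomputable def NP (μ₁ μ₂ θ ρ α : ℝ) (n : ℕ) (E : Set (ℕ × ℕ × ℕ)) : ℝ :=
  (∑' t : E, Nwt μ₁ μ₂ θ ρ α n t) / (∑' t : ℕ × ℕ × ℕ, Nwt μ₁ μ₂ θ ρ α n t)

/-- The weight `m (m - 1) ⋯ (m - k + 1) c ^ k`; with `m = n₂` and `c = μ₂ / λ₁` it is the common
factor of all interior weights with a given value of `k`. -/
noncomputable def descWeight (m : ℕ) (c : ℝ) (k : ℕ) : ℝ := (m.descFactorial k : ℝ) * c ^ k

theorem descWeight_nonneg {m : ℕ} {c : ℝ} (hc : 0 ≤ c) (k : ℕ) : 0 ≤ descWeight m c k := by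
  unfold descWeight; positivity

theorem descWeight_succ {m k : ℕ} (hk : k ≤ m) (c : ℝ) :
    descWeight m c (k + 1) = ((m : ℝ) - k) * c * descWeight m c k := by
  simp only [descWeight, Nat.descFactorial_succ, pow_succ]
  push_cast [hk]
  ring

theorem mul_pow_le_descFactorial {x : ℝ} {m i R : ℕ} (hx : 0 ≤ x)
    (hR : (R : ℝ) ≤ (1 - x) * m) (hi : i ≤ R) :
    (x * m) ^ i ≤ (m.descFactorial i : ℝ) := by
  have h := Nat.pow_sub_le_descFactorial m i
  have h' : (((m + 1 - i : ℕ) : ℝ)) ^ i ≤ (m.descFactorial i : ℝ) := by exact_mod_cast h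
  refine le_trans (pow_le_pow_left₀ (by positivity) ?_ i) h'
  have h1 : ((m + 1 : ℕ) : ℝ) ≤ ((m + 1 - i : ℕ) : ℝ) + i := by
    exact_mod_cast (by omega : m + 1 ≤ (m + 1 - i) + i)
  have h2 : (i : ℝ) ≤ R := by exact_mod_cast hi
  push_cast at h1
  linarith

theorem interior_weight_eq (n₁ n₂ k i j : ℕ) {μ₁ μ₂ α lam : ℝ} (hα : 0 < α) (hlam : 0 < lam) :
    (n₁.choose (i + 1) : ℝ) * (n₂.choose (k + j) : ℝ) * ((i + 1 : ℕ) : ℝ) *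
      ((i + 1 + (k + j) - k - 1).factorial : ℝ) *
      (((k + j).factorial : ℝ) / ((k + j - k).factorial : ℝ)) *
      μ₁ ^ (i + 1) * μ₂ ^ (k + j) * (lam ^ (i + 1 + (k + j)))⁻¹ * (lam / (α * lam)) ^ k =
    descWeight n₂ (μ₂ / (α * lam)) k *
      ((n₁.descFactorial (i + 1) : ℝ) * (μ₁ / lam) ^ (i + 1) *
        (((n₂ - k).descFactorial j : ℝ) * (μ₂ / lam) ^ j) * ((i + j).choose i : ℝ)) := by
  have e1 : i + 1 + (k + j) - k - 1 = i + j := by omega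
  have e2 : k + j - k = j := by omega
  have h1 : (n₁.descFactorial (i + 1) : ℝ) = (i + 1) * (i.factorial : ℝ) * n₁.choose (i + 1) := by
    rw [Nat.descFactorial_eq_factorial_mul_choose, Nat.factorial_succ]; push_cast; ring
  have h2 : ((n₂ - k).descFactorial j : ℝ) * n₂.descFactorial k =
      (k + j).factorial * n₂.choose (k + j) := by
    have := Nat.descFactorial_mul_descFactorial (n := n₂) (k := k) (m := k + j) (by omega)
    rw [e2, Nat.descFactorial_eq_factorial_mul_choose n₂ (k + j)] at this
    exact_mod_cast this
  have h3 : ((i + j).factorial : ℝ) = (i + j).choose i * i.factorial * j.factorial := by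
    exact_mod_cast (Nat.choose_symm_add (a := i) (b := j) ▸
      (Nat.add_choose_mul_factorial_mul_factorial i j).symm)
  rw [e1, e2, descWeight, h3, h1]
  have hj : (j.factorial : ℝ) ≠ 0 := by positivity
  have hl := hlam.ne'
  have ha := hα.ne'
  simp only [div_pow, mul_pow, pow_add, pow_one]
  push_cast
  field_simp
  linear_combination (-(n₁.choose (i + 1) : ℝ) * ((i + j).choose i) *
    μ₁ * μ₁ ^ i * μ₂ ^ k * μ₂ ^ j) * h2

theorem interior_weight_ge {n₁ n₂ k i j R : ℕ} {μ₁ μ₂ α lam x : ℝ} (hα : 0 < α) (hlam : 0 < lam)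
    (hμ₁ : 0 < μ₁) (hμ₂ : 0 < μ₂) (hx : 0 ≤ x)
    (hR₁ : (R : ℝ) ≤ (1 - x) * n₁) (hR₂ : (R : ℝ) ≤ (1 - x) * (n₂ - k : ℕ)) (hij : i + j < R) :
    descWeight n₂ (μ₂ / (α * lam)) k * (x * n₁ * μ₁ / lam) *
      ((x * n₁ * μ₁ / lam) ^ i * (x * (n₂ - k : ℕ) * μ₂ / lam) ^ j * ((i + j).choose i : ℝ)) ≤
    (n₁.choose (i + 1) : ℝ) * (n₂.choose (k + j) : ℝ) * ((i + 1 : ℕ) : ℝ) *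
      ((i + 1 + (k + j) - k - 1).factorial : ℝ) *
      (((k + j).factorial : ℝ) / ((k + j - k).factorial : ℝ)) *
      μ₁ ^ (i + 1) * μ₂ ^ (k + j) * (lam ^ (i + 1 + (k + j)))⁻¹ * (lam / (α * lam)) ^ k := by
  rw [interior_weight_eq n₁ n₂ k i j hα hlam, mul_assoc]
  have hd := descWeight_nonneg (m := n₂) (c := μ₂ / (α * lam)) (by positivity) k
  refine mul_le_mul_of_nonneg_left ?_ hd
  have h1 := mul_pow_le_descFactorial hx hR₁ (by omega : i + 1 ≤ R)
  have h2 := mul_pow_le_descFactorial hx hR₂ (by omega : j ≤ R)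
  calc _ = (x * n₁) ^ (i + 1) * (μ₁ / lam) ^ (i + 1) *
        ((x * (n₂ - k : ℕ)) ^ j * (μ₂ / lam) ^ j) * ((i + j).choose i : ℝ) := by
        rw [← mul_pow, ← mul_pow]; ring
    _ ≤ _ := by gcongr

theorem sum_antidiagonal_le_sum_box {f : ℕ → ℕ → ℝ} {a b R : ℕ} (hf : ∀ i j, 0 ≤ f i j)
    (ha : R ≤ a) (hb : R ≤ b) :
    ∑ N ∈ Finset.range R, ∑ p ∈ Finset.HasAntidiagonal.antidiagonal N, f p.1 p.2 ≤
      ∑ i ∈ Finset.range a, ∑ j ∈ Finset.range b, f i j := by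
  rw [← Finset.sum_product']
  let S := (Finset.range a ×ˢ Finset.range b).filter (fun p : ℕ × ℕ => p.1 + p.2 < R)
  have h := Finset.sum_fiberwise_of_maps_to (s := S) (t := Finset.range R)
    (g := fun p : ℕ × ℕ => p.1 + p.2) (by intro p hp; simpa using (Finset.mem_filter.1 hp).2)
    (fun p => f p.1 p.2)
  have h2 : ∑ N ∈ Finset.range R, ∑ p ∈ Finset.HasAntidiagonal.antidiagonal N, f p.1 p.2 =
      ∑ p ∈ S, f p.1 p.2 := by
    rw [← h]
    refine Finset.sum_congr rfl fun N hN => Finset.sum_congr ?_ fun _ _ => rfl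
    ext ⟨u, v⟩
    simp only [S, Finset.mem_range, Finset.HasAntidiagonal.mem_antidiagonal, Finset.mem_filter,
      Finset.mem_product] at hN ⊢
    omega
  rw [h2]
  exact Finset.sum_le_sum_of_subset_of_nonneg (Finset.filter_subset _ _) fun p _ _ => hf _ _

/-- Each extra pool-2 server contributes a factor at most `s` to a boundary weight. -/
theorem boundary_prod_le {n n₁ n₂ h : ℕ} {μ₁ μ₂ lam₂ s : ℝ} (hn : n = n₁ + n₂) (hn₁ : 1 ≤ n₁)
    (hμ₂ : 0 < μ₂) (hs : 0 < s) (hs1 : s < 1)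
    (hE : (n₂ + 1) * μ₂ ≤ s * (μ₁ * n₁ - lam₂ + n₂ * μ₂)) (k : ℕ) (hhk : h ≤ k) (hk : k ≤ n₂) :
    0 ≤ ∏ j ∈ Finset.Icc (n - k) (n - (h + 1)), (μ₁ * (n₁ : ℝ) + μ₂ * ((j : ℝ) - n₁) - lam₂)⁻¹ ∧
    (n₂.descFactorial k : ℝ) * μ₂ ^ k *
      ∏ j ∈ Finset.Icc (n - k) (n - (h + 1)), (μ₁ * (n₁ : ℝ) + μ₂ * ((j : ℝ) - n₁) - lam₂)⁻¹ ≤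
    (n₂.descFactorial h : ℝ) * μ₂ ^ h * s ^ (k - h) := by
  induction k, hhk using Nat.le_induction with
  | base =>
    rw [Finset.Icc_eq_empty (by omega)]
    simp
  | succ k hhk ih =>
    obtain ⟨ih0, ih⟩ := ih (by omega)
    have hI : Finset.Icc (n - (k + 1)) (n - (h + 1)) =
        insert (n - (k + 1)) (Finset.Icc (n - k) (n - (h + 1))) := by
      ext j; simp only [Finset.mem_Icc, Finset.mem_insert]; omega
    rw [hI, Finset.prod_insert (by simp only [Finset.mem_Icc]; omega)]
    have hc : ((n - (k + 1) : ℕ) : ℝ) = n₁ + n₂ - (k + 1) := by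
      rw [hn, Nat.cast_sub (by omega)]; push_cast; ring
    have hkr : (k : ℝ) + 1 ≤ n₂ := by exact_mod_cast hk
    rw [hc]
    have key : ((n₂ : ℝ) - k) * μ₂ ≤
        s * (μ₁ * (n₁ : ℝ) + μ₂ * ((n₁ : ℝ) + n₂ - (k + 1) - n₁) - lam₂) := by
      have : 0 ≤ (1 - s) * (k + 1) * μ₂ := by
        have : 0 < 1 - s := by linarith
        positivity
      nlinarith
    have hD : 0 < μ₁ * (n₁ : ℝ) + μ₂ * ((n₁ : ℝ) + n₂ - (k + 1) - n₁) - lam₂ := by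
      have : 0 < ((n₂ : ℝ) - k) * μ₂ := mul_pos (by linarith) hμ₂
      exact pos_of_mul_pos_right (this.trans_le key) hs.le
    set D := μ₁ * (n₁ : ℝ) + μ₂ * ((n₁ : ℝ) + n₂ - (k + 1) - n₁) - lam₂
    set P := ∏ j ∈ Finset.Icc (n - k) (n - (h + 1)), (μ₁ * (n₁ : ℝ) + μ₂ * ((j : ℝ) - n₁) - lam₂)⁻¹
    refine ⟨by positivity, ?_⟩
    have hkey : ((n₂ : ℝ) - k) * μ₂ * D⁻¹ ≤ s := by
      rw [← div_eq_mul_inv, div_le_iff₀ hD]; exact key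
    calc _ = ((n₂ : ℝ) - k) * μ₂ * D⁻¹ * ((n₂.descFactorial k : ℝ) * μ₂ ^ k * P) := by
          rw [Nat.descFactorial_succ, Nat.cast_mul, Nat.cast_sub (by omega)]; ring
      _ ≤ s * ((n₂.descFactorial h : ℝ) * μ₂ ^ h * s ^ (k - h)) := by
          gcongr
      _ = _ := by
          rw [show k + 1 - h = (k - h) + 1 by omega, pow_succ]; ring

theorem factorial_div_eq_descFactorial {m k : ℕ} (hk : k ≤ m) :
    (m.factorial : ℝ) / ((m - k).factorial : ℝ) = m.descFactorial k := by
  rw [div_eq_iff (by positivity), mul_comm]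
  exact_mod_cast (Nat.factorial_mul_descFactorial hk).symm

theorem sum_shifted_geom_le {s : ℝ} (hs : 0 < s) (hs1 : s < 1) (h m : ℕ) :
    ∑ k ∈ Finset.range m, (if h ≤ k then s ^ (k - h) else 0) ≤ (1 - s)⁻¹ := by
  have hsum := summable_geometric_of_lt_one hs.le hs1
  rw [← Finset.sum_filter, ← tsum_geometric_of_lt_one hs.le hs1]
  have : ∑ k ∈ (Finset.range m).filter (h ≤ ·), s ^ (k - h) = ∑ k ∈ Finset.range (m - h), s ^ k := by
    refine Finset.sum_nbij' (· - h) (· + h) ?_ ?_ ?_ ?_ ?_ <;> simp <;> intros <;> omega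
  rw [this]
  exact hsum.sum_le_tsum _ fun _ _ => by positivity

theorem exists_factor_lt_one {l a b c : ℝ} (hl : l < 1) (h : c < a + b) :
    ∃ x, l < x ∧ x < 1 ∧ c < x * a + b := by
  have hc : ContinuousAt (fun x : ℝ => x * a + b) 1 := by fun_prop
  have h1 : ∀ᶠ x in nhdsWithin 1 (Set.Iio 1), c < x * a + b :=
    (hc.eventually_const_lt (by simpa using h)).filter_mono nhdsWithin_le_nhds
  have h2 : ∀ᶠ x in nhdsWithin (1 : ℝ) (Set.Iio 1), l < x :=
    (eventually_gt_nhds hl).filter_mono nhdsWithin_le_nhds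
  obtain ⟨x, hx1, hx2, hx3⟩ := (h1.and (h2.and self_mem_nhdsWithin)).exists
  exact ⟨x, hx2, hx3, hx1⟩

theorem Npool_add {θ : ℝ} (hθ : θ ∈ Set.Ioo (0 : ℝ) 1) (n : ℕ) :
    n = Npool1 θ n + Npool2 θ n := by
  have : Npool1 θ n ≤ n := by
    rw [Npool1, Nat.ceil_le]
    exact mul_le_of_le_one_left (by positivity) hθ.2.le
  rw [Npool2]; omega

theorem Npool_linear_tendsto {θ a b : ℝ} (hθ : θ ∈ Set.Ioo (0 : ℝ) 1)
    (hab : 0 < a * θ + b * (1 - θ)) :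
    Tendsto (fun n : ℕ => a * (Npool1 θ n : ℝ) + b * (Npool2 θ n : ℝ)) atTop atTop := by
  have h1 : Tendsto (fun n : ℕ => (Npool1 θ n : ℝ) / n) atTop (nhds θ) :=
    (tendsto_nat_ceil_mul_div_atTop hθ.1.le).comp tendsto_natCast_atTop_atTop
  have h2 : Tendsto (fun n : ℕ => a * ((Npool1 θ n : ℝ) / n) + b * (1 - (Npool1 θ n : ℝ) / n))
      atTop (nhds (a * θ + b * (1 - θ))) :=
    (h1.const_mul a).add ((h1.const_sub 1).const_mul b)
  refine (h2.pos_mul_atTop hab tendsto_natCast_atTop_atTop).congr' ?_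
  filter_upwards [eventually_gt_atTop 0] with n hn
  have hn' : (n : ℝ) ≠ 0 := by positivity
  have h3 : (n : ℝ) = Npool1 θ n + Npool2 θ n := by exact_mod_cast Npool_add hθ n
  have h4 : (Npool2 θ n : ℝ) = n - Npool1 θ n := by linarith
  rw [h4]
  field_simp

theorem Nwt_eq_zero_of_notMem (μ₁ μ₂ θ ρ α : ℝ) (n : ℕ) (t : ℕ × ℕ × ℕ)
    (ht : t ∉ Finset.range (Npool2 θ n + 1) ×ˢ
      (Finset.range (Npool1 θ n + 1) ×ˢ Finset.range (Npool2 θ n + 1))) :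
    Nwt μ₁ μ₂ θ ρ α n t = 0 := by
  simp only [Finset.mem_product, Finset.mem_range] at ht
  simp only [Nwt]
  rw [if_neg (by omega), if_neg (by omega), if_neg (by omega)]

theorem tsum_Nwt_eq (μ₁ μ₂ θ ρ α : ℝ) (n : ℕ) :
    ∑' t : ℕ × ℕ × ℕ, Nwt μ₁ μ₂ θ ρ α n t =
      (∑ k ∈ Finset.range (Npool2 θ n + 1), ∑ i ∈ Finset.range (Npool1 θ n),
        ∑ j ∈ Finset.range (Npool2 θ n + 1), Nwt μ₁ μ₂ θ ρ α n (k, i + 1, j)) +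
      ∑ k ∈ Finset.range (Npool2 θ n + 1),
        ∑ j ∈ Finset.range (Npool2 θ n + 1), Nwt μ₁ μ₂ θ ρ α n (k, 0, j) := by
  rw [tsum_eq_sum (Nwt_eq_zero_of_notMem μ₁ μ₂ θ ρ α n), Finset.sum_product,
    ← Finset.sum_add_distrib]
  refine Finset.sum_congr rfl fun k _ => ?_
  rw [Finset.sum_product, Finset.sum_range_succ']

theorem tsum_Nwt_boundary_eq (μ₁ μ₂ θ ρ α : ℝ) (n : ℕ) :
    ∑' t : {t : ℕ × ℕ × ℕ | t.2.1 = 0}, Nwt μ₁ μ₂ θ ρ α n t =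
      ∑ k ∈ Finset.range (Npool2 θ n + 1),
        ∑ j ∈ Finset.range (Npool2 θ n + 1), Nwt μ₁ μ₂ θ ρ α n (k, 0, j) := by
  rw [tsum_subtype {t : ℕ × ℕ × ℕ | t.2.1 = 0} (Nwt μ₁ μ₂ θ ρ α n),
    tsum_eq_sum (s := Finset.range (Npool2 θ n + 1) ×ˢ
      (Finset.range (Npool1 θ n + 1) ×ˢ Finset.range (Npool2 θ n + 1))), Finset.sum_product]
  · refine Finset.sum_congr rfl fun k _ => ?_
    rw [Finset.sum_product, Finset.sum_range_succ']
    simp [Set.indicator]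
  · intro t ht
    simp [Set.indicator, Nwt_eq_zero_of_notMem μ₁ μ₂ θ ρ α n t ht]

theorem Nwt_interior_nonneg {μ₁ μ₂ θ ρ α : ℝ} {n : ℕ} (hμ₁ : 0 < μ₁) (hμ₂ : 0 < μ₂)
    (hα : 0 < α) (hlam : 0 < Nlam μ₁ μ₂ θ ρ n) (k i j : ℕ) :
    0 ≤ Nwt μ₁ μ₂ θ ρ α n (k, i + 1, j) := by
  simp only [Nwt]
  split_ifs with _ h h
  · positivity
  · exact absurd h.2.2.1 (by simp)
  · exact absurd h.2.1 (by simp)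
  · exact le_rfl

theorem Nwt_zero_zero_mem_Icc {μ₁ μ₂ θ ρ α s : ℝ} {n k : ℕ} (hμ₁ : 0 < μ₁) (hμ₂ : 0 < μ₂)
    (hn : n = Npool1 θ n + Npool2 θ n) (hn₁ : 1 ≤ Npool1 θ n)
    (hρ : ρ < 1) (hs : 0 < s) (hs1 : s < 1)
    (hE : (Npool2 θ n + 1) * μ₂ ≤
      s * (μ₁ * Npool1 θ n - (1 - α) * Nlam μ₁ μ₂ θ ρ n + Npool2 θ n * μ₂))
    (hk : k ≤ Npool2 θ n) :
    Nwt μ₁ μ₂ θ ρ α n (k, 0, 0) ∈ Set.Icc 0 ((1 - ρ)⁻¹ * s ^ k) := by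
  obtain ⟨h0, h1⟩ := boundary_prod_le hn hn₁ hμ₂ hs hs1 hE k (Nat.zero_le k) hk
  simp only [Nwt]
  rw [if_neg (by omega), if_neg (by omega), if_pos (by simpa using hk),
    factorial_div_eq_descFactorial hk]
  simp only [zero_add, Nat.descFactorial_zero, pow_zero, Nat.cast_one, one_mul,
    Nat.sub_zero] at h0 h1
  set P := ∏ j ∈ Finset.Icc (n - k) (n - 1),
    (μ₁ * (Npool1 θ n : ℝ) + μ₂ * ((j : ℝ) - Npool1 θ n) - (1 - α) * Nlam μ₁ μ₂ θ ρ n)⁻¹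
  have hn₁' : (1 : ℝ) ≤ Npool1 θ n := by exact_mod_cast hn₁
  have hΛ : 0 < μ₁ * (Npool1 θ n : ℝ) + μ₂ * (Npool2 θ n : ℝ) := by positivity
  have hD : μ₁ * (Npool1 θ n : ℝ) + μ₂ * (Npool2 θ n : ℝ) - Nlam μ₁ μ₂ θ ρ n =
      (1 - ρ) * (μ₁ * (Npool1 θ n : ℝ) + μ₂ * (Npool2 θ n : ℝ)) := by rw [Nlam]; ring
  rw [hD]
  have h1ρ : 0 < 1 - ρ := by linarith
  refine ⟨by positivity, ?_⟩
  have hfac : μ₁ * (Npool1 θ n : ℝ) *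
      ((1 - ρ) * (μ₁ * (Npool1 θ n : ℝ) + μ₂ * (Npool2 θ n : ℝ)))⁻¹ ≤ (1 - ρ)⁻¹ := by
    rw [mul_inv, mul_left_comm]
    refine mul_le_of_le_one_right (by positivity) ?_
    rw [← div_eq_mul_inv, div_le_one hΛ]
    have : 0 ≤ μ₂ * (Npool2 θ n : ℝ) := by positivity
    linarith
  calc _ = (μ₁ * (Npool1 θ n : ℝ) *
      ((1 - ρ) * (μ₁ * (Npool1 θ n : ℝ) + μ₂ * (Npool2 θ n : ℝ)))⁻¹) *
        (((Npool2 θ n).descFactorial k : ℝ) * μ₂ ^ k * P) := by ring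
    _ ≤ _ := by gcongr

theorem mul_div_lam_le {μ₁ μ₂ θ ρ α a : ℝ} {n : ℕ} (hα : 0 < α) (hρ : 0 < ρ)
    (hlam : 0 < Nlam μ₁ μ₂ θ ρ n)
    (ha : a ≤ (Npool1 θ n : ℝ) * μ₁ + (Npool2 θ n : ℝ) * μ₂) :
    a / (α * Nlam μ₁ μ₂ θ ρ n) ≤ (α * ρ)⁻¹ := by
  rw [div_le_iff₀ (by positivity)]
  refine ha.trans_eq ?_
  rw [Nlam]
  field_simp

theorem Nwt_zero_succ_mem_Icc {μ₁ μ₂ θ ρ α s : ℝ} {n k h : ℕ} (hμ₁ : 0 < μ₁) (hμ₂ : 0 < μ₂)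
    (hα : 0 < α) (hlam : 0 < Nlam μ₁ μ₂ θ ρ n)
    (hn : n = Npool1 θ n + Npool2 θ n) (hn₁ : 1 ≤ Npool1 θ n)
    (hρ : 0 < ρ) (hs : 0 < s) (hs1 : s < 1)
    (hE : (Npool2 θ n + 1) * μ₂ ≤
      s * (μ₁ * Npool1 θ n - (1 - α) * Nlam μ₁ μ₂ θ ρ n + Npool2 θ n * μ₂))
    (hk : k ≤ Npool2 θ n) :
    Nwt μ₁ μ₂ θ ρ α n (k, 0, h + 1) ∈ Set.Icc 0
      ((α * ρ)⁻¹ * descWeight (Npool2 θ n) (μ₂ / (α * Nlam μ₁ μ₂ θ ρ n)) h *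
        (if h ≤ k then s ^ (k - h) else 0)) := by
  have hd := descWeight_nonneg (m := Npool2 θ n) (c := μ₂ / (α * Nlam μ₁ μ₂ θ ρ n))
    (by positivity) h
  by_cases hhk : h + 1 ≤ k
  · obtain ⟨h0, h1⟩ := boundary_prod_le hn hn₁ hμ₂ hs hs1 hE k (by omega : h ≤ k) hk
    rw [if_pos (by omega : h ≤ k)]
    simp only [Nwt]
    rw [if_neg (by omega), if_pos (by simp only [true_and]; omega),
      factorial_div_eq_descFactorial hk]
    set P := ∏ j ∈ Finset.Icc (n - k) (n - (h + 1)),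
      (μ₁ * (Npool1 θ n : ℝ) + μ₂ * ((j : ℝ) - Npool1 θ n) - (1 - α) * Nlam μ₁ μ₂ θ ρ n)⁻¹
    refine ⟨by positivity, ?_⟩
    have hfac := mul_div_lam_le (a := (Npool1 θ n : ℝ) * μ₁) hα hρ hlam
      (le_add_of_nonneg_right (by positivity))
    calc _ = ((Npool1 θ n : ℝ) * μ₁ / (α * Nlam μ₁ μ₂ θ ρ n)) *
          ((α * Nlam μ₁ μ₂ θ ρ n) ^ h)⁻¹ *
          (((Npool2 θ n).descFactorial k : ℝ) * μ₂ ^ k * P) := by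
          rw [pow_succ, mul_inv]; ring
      _ ≤ (α * ρ)⁻¹ * ((α * Nlam μ₁ μ₂ θ ρ n) ^ h)⁻¹ *
          (((Npool2 θ n).descFactorial h : ℝ) * μ₂ ^ h * s ^ (k - h)) := by gcongr
      _ = _ := by rw [descWeight, div_pow]; ring
  · have hw : Nwt μ₁ μ₂ θ ρ α n (k, 0, h + 1) = 0 := by
      simp only [Nwt]
      rw [if_neg (by omega), if_neg (by simp only [true_and]; omega), if_neg (by simp)]
    rw [hw]
    refine ⟨le_rfl, ?_⟩
    split_ifs <;> positivity

theorem boundary_sum_mem_Icc {μ₁ μ₂ θ ρ α s : ℝ} {n : ℕ} (hμ₁ : 0 < μ₁) (hμ₂ : 0 < μ₂)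
    (hα : 0 < α) (hlam : 0 < Nlam μ₁ μ₂ θ ρ n)
    (hn : n = Npool1 θ n + Npool2 θ n) (hn₁ : 1 ≤ Npool1 θ n)
    (hρ : 0 < ρ) (hρ1 : ρ < 1) (hs : 0 < s) (hs1 : s < 1)
    (hE : (Npool2 θ n + 1) * μ₂ ≤
      s * (μ₁ * Npool1 θ n - (1 - α) * Nlam μ₁ μ₂ θ ρ n + Npool2 θ n * μ₂)) :
    ∑ k ∈ Finset.range (Npool2 θ n + 1), ∑ j ∈ Finset.range (Npool2 θ n + 1),
      Nwt μ₁ μ₂ θ ρ α n (k, 0, j) ∈ Set.Icc 0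
      (((α * ρ)⁻¹ + (1 - ρ)⁻¹) * (1 - s)⁻¹ *
        ∑ k ∈ Finset.range (Npool2 θ n + 1),
          descWeight (Npool2 θ n) (μ₂ / (α * Nlam μ₁ μ₂ θ ρ n)) k) := by
  set p := descWeight (Npool2 θ n) (μ₂ / (α * Nlam μ₁ μ₂ θ ρ n)) with hp
  have hp0 : ∀ k, 0 ≤ p k := descWeight_nonneg (by positivity)
  have hz : ∀ k ∈ Finset.range (Npool2 θ n + 1), _ := fun k hk =>
    Nwt_zero_zero_mem_Icc (α := α) hμ₁ hμ₂ hn hn₁ hρ1 hs hs1 hE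
      (Nat.lt_succ_iff.1 (Finset.mem_range.1 hk))
  have hb : ∀ h, ∀ k ∈ Finset.range (Npool2 θ n + 1), _ := fun h k hk =>
    Nwt_zero_succ_mem_Icc (h := h) hμ₁ hμ₂ hα hlam hn hn₁ hρ hs hs1 hE
      (Nat.lt_succ_iff.1 (Finset.mem_range.1 hk))
  have h1ρ : 0 < 1 - ρ := by linarith
  have h1s : 0 < 1 - s := by linarith
  rw [Finset.sum_comm, Finset.sum_range_succ' (fun j => ∑ k ∈ Finset.range (Npool2 θ n + 1),
    Nwt μ₁ μ₂ θ ρ α n (k, 0, j))]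
  constructor
  · exact add_nonneg (Finset.sum_nonneg fun h _ => Finset.sum_nonneg fun k hk => (hb h k hk).1)
      (Finset.sum_nonneg fun k hk => (hz k hk).1)
  rw [add_mul, add_mul]
  refine add_le_add ?_ ?_
  · calc _ ≤ ∑ h ∈ Finset.range (Npool2 θ n), (α * ρ)⁻¹ * p h * (1 - s)⁻¹ := by
          refine Finset.sum_le_sum fun h _ => ?_
          refine (Finset.sum_le_sum fun k hk => (hb h k hk).2).trans ?_
          rw [← Finset.mul_sum]
          exact mul_le_mul_of_nonneg_left (sum_shifted_geom_le hs hs1 h _)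
            (mul_nonneg (by positivity) (hp0 h))
      _ = (α * ρ)⁻¹ * (1 - s)⁻¹ * ∑ h ∈ Finset.range (Npool2 θ n), p h := by
          rw [Finset.mul_sum]; exact Finset.sum_congr rfl fun _ _ => by ring
      _ ≤ _ := by
          refine mul_le_mul_of_nonneg_left ?_ (by positivity)
          rw [Finset.sum_range_succ]
          exact le_add_of_nonneg_right (hp0 _)
  · refine (Finset.sum_le_sum fun k hk => (hz k hk).2).trans ?_
    rw [← Finset.mul_sum, mul_assoc]
    refine mul_le_mul_of_nonneg_left ?_ (by positivity)
    have hg := sum_shifted_geom_le hs hs1 0 (Npool2 θ n + 1)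
    simp only [Nat.zero_le, if_true, Nat.sub_zero] at hg
    refine hg.trans (le_mul_of_one_le_right (by positivity) ?_)
    have h1 : p 0 = 1 := by simp [hp, descWeight]
    rw [← h1]
    exact Finset.single_le_sum (f := p) (fun k _ => hp0 k) (by simp)

theorem descWeight_mul_le_interior_sum {μ₁ μ₂ θ ρ α x a₀ : ℝ} {n k R : ℕ}
    (hμ₁ : 0 < μ₁) (hμ₂ : 0 < μ₂) (hα : 0 < α) (hlam : 0 < Nlam μ₁ μ₂ θ ρ n)
    (hx : 0 ≤ x) (hk : k ≤ Npool2 θ n)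
    (hR₁ : (R : ℝ) ≤ (1 - x) * Npool1 θ n) (hR₂ : (R : ℝ) ≤ (1 - x) * (Npool2 θ n - k : ℕ))
    (ha₀ : a₀ * Nlam μ₁ μ₂ θ ρ n ≤ x * Npool1 θ n * μ₁)
    (hsum : Nlam μ₁ μ₂ θ ρ n ≤ x * (Npool1 θ n * μ₁ + (Npool2 θ n - k : ℕ) * μ₂)) :
    descWeight (Npool2 θ n) (μ₂ / (α * Nlam μ₁ μ₂ θ ρ n)) k * (a₀ * R) ≤
      ∑ i ∈ Finset.range (Npool1 θ n), ∑ j ∈ Finset.range (Npool2 θ n + 1),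
        Nwt μ₁ μ₂ θ ρ α n (k, i + 1, j) := by
  have hnn := Nwt_interior_nonneg hμ₁ hμ₂ hα hlam
  have hR₁' : R ≤ Npool1 θ n := by
    have : (R : ℝ) ≤ Npool1 θ n :=
      hR₁.trans (mul_le_of_le_one_left (by positivity) (by linarith))
    exact_mod_cast this
  have hR₂' : R ≤ Npool2 θ n - k := by
    have : (R : ℝ) ≤ (Npool2 θ n - k : ℕ) :=
      hR₂.trans (mul_le_of_le_one_left (by positivity) (by linarith))
    exact_mod_cast this
  have hstep1 : ∑ i ∈ Finset.range (Npool1 θ n), ∑ j ∈ Finset.range (Npool2 θ n + 1 - k),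
        Nwt μ₁ μ₂ θ ρ α n (k, i + 1, k + j) ≤
      ∑ i ∈ Finset.range (Npool1 θ n), ∑ j ∈ Finset.range (Npool2 θ n + 1),
        Nwt μ₁ μ₂ θ ρ α n (k, i + 1, j) := by
    refine Finset.sum_le_sum fun i _ => ?_
    rw [← Finset.sum_Ico_eq_sum_range (fun j => Nwt μ₁ μ₂ θ ρ α n (k, i + 1, j))]
    refine Finset.sum_le_sum_of_subset_of_nonneg ?_ fun j _ _ => hnn k i j
    intro j hj
    simp only [Finset.mem_Ico, Finset.mem_range] at hj ⊢
    omega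
  refine le_trans ?_ hstep1
  refine le_trans ?_ (sum_antidiagonal_le_sum_box (R := R)
    (f := fun i j => Nwt μ₁ μ₂ θ ρ α n (k, i + 1, k + j)) (fun i j => hnn k i (k + j))
    hR₁' (by omega))
  set p := descWeight (Npool2 θ n) (μ₂ / (α * Nlam μ₁ μ₂ θ ρ n)) k
  have hp0 : 0 ≤ p := descWeight_nonneg (by positivity) k
  set lam := Nlam μ₁ μ₂ θ ρ n with hl
  set a := x * Npool1 θ n * μ₁ / lam with ha
  set b := x * (Npool2 θ n - k : ℕ) * μ₂ / lam with hb
  have hab : 1 ≤ a + b := by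
    rw [ha, hb, ← add_div, le_div_iff₀ hlam]
    linarith
  have haa : a₀ ≤ a := by rwa [ha, le_div_iff₀ hlam]
  have ha_nn : 0 ≤ a := by positivity
  calc p * (a₀ * R) ≤ p * (a * R) := by gcongr
    _ = ∑ N ∈ Finset.range R, p * a := by
        rw [Finset.sum_const, Finset.card_range, nsmul_eq_mul]; ring
    _ ≤ _ := by
      refine Finset.sum_le_sum fun N hN => ?_
      calc p * a ≤ p * a * (a + b) ^ N :=
            le_mul_of_one_le_right (mul_nonneg hp0 ha_nn) (one_le_pow₀ hab)
        _ = ∑ q ∈ Finset.HasAntidiagonal.antidiagonal N,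
              p * a * (a ^ q.1 * b ^ q.2 * ((q.1 + q.2).choose q.1 : ℝ)) := by
            rw [(Commute.all a b).add_pow', Finset.mul_sum]
            refine Finset.sum_congr rfl fun q hq => ?_
            rw [Finset.HasAntidiagonal.mem_antidiagonal.1 hq, nsmul_eq_mul]; ring
        _ ≤ _ := by
            refine Finset.sum_le_sum fun q hq => ?_
            have hqN := Finset.HasAntidiagonal.mem_antidiagonal.1 hq
            have hNR := Finset.mem_range.1 hN
            refine (interior_weight_ge (i := q.1) (j := q.2) hα hlam hμ₁ hμ₂ hx hR₁ hR₂
              (by omega)).trans ?_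
            simp only [Nwt]
            rw [if_pos (by omega)]

/-- If `p` contracts by a factor `r` up to errors controlled by `B`, its sum is controlled by the
sum of `B`. -/
theorem sum_le_of_contraction {p B : ℕ → ℝ} {r q q' : ℝ} {m : ℕ} (hp : ∀ k, 0 ≤ p k)
    (hB : ∀ k, 0 ≤ B k) (hr : 0 ≤ r) (hq : 0 ≤ q) (hq' : 0 ≤ q') (h0 : p 0 ≤ q * B 0)
    (hsucc : ∀ k < m, p (k + 1) ≤ r * p k + q' * B k) :
    (1 - r) * ∑ k ∈ Finset.range (m + 1), p k ≤ (q + q') * ∑ k ∈ Finset.range (m + 1), B k := by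
  have h1 : ∑ k ∈ Finset.range m, p (k + 1) ≤
      r * ∑ k ∈ Finset.range m, p k + q' * ∑ k ∈ Finset.range m, B k := by
    rw [Finset.mul_sum, Finset.mul_sum, ← Finset.sum_add_distrib]
    exact Finset.sum_le_sum fun k hk => hsucc k (Finset.mem_range.1 hk)
  have h2 : r * ∑ k ∈ Finset.range m, p k ≤ r * ∑ k ∈ Finset.range (m + 1), p k := by
    refine mul_le_mul_of_nonneg_left ?_ hr
    rw [Finset.sum_range_succ]; linarith [hp m]
  have h3 : q' * ∑ k ∈ Finset.range m, B k ≤ q' * ∑ k ∈ Finset.range (m + 1), B k := by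
    refine mul_le_mul_of_nonneg_left ?_ hq'
    rw [Finset.sum_range_succ]; linarith [hB m]
  have h4 : q * B 0 ≤ q * ∑ k ∈ Finset.range (m + 1), B k :=
    mul_le_mul_of_nonneg_left (Finset.single_le_sum (fun k _ => hB k) (by simp)) hq
  have h5 := Finset.sum_range_succ' p m
  linarith

theorem NP_no_idle_mem_Icc {μ₁ μ₂ θ ρ α x r s : ℝ} {n R : ℕ}
    (hμ₁ : 0 < μ₁) (hμ₂ : 0 < μ₂) (hα : 0 < α) (hα1 : α ≤ 1)
    (hn : n = Npool1 θ n + Npool2 θ n) (hn₁ : 1 ≤ Npool1 θ n)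
    (hρ : 0 < ρ) (hρ1 : ρ < 1) (hs : 0 < s) (hs1 : s < 1) (hr : 0 < r) (hr1 : r < 1)
    (hxρ : ρ < x) (hx1 : x < 1) (hR : 0 < R)
    (hE : (Npool2 θ n + 1) * μ₂ ≤
      s * (μ₁ * Npool1 θ n - (1 - α) * Nlam μ₁ μ₂ θ ρ n + Npool2 θ n * μ₂))
    (hX : Nlam μ₁ μ₂ θ ρ n ≤ x * (Npool1 θ n * μ₁ + r * (α * Nlam μ₁ μ₂ θ ρ n)))
    (hR₁ : (R : ℝ) ≤ (1 - x) * Npool1 θ n) (hR₂ : (R : ℝ) ≤ (1 - x) * Npool2 θ n)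
    (hR₃ : (R : ℝ) * μ₂ ≤ (1 - x) * (r * (α * Nlam μ₁ μ₂ θ ρ n))) :
    NP μ₁ μ₂ θ ρ α n {t : ℕ × ℕ × ℕ | t.2.1 = 0} ∈ Set.Icc 0
      (((α * ρ)⁻¹ + (1 - ρ)⁻¹) * (1 - s)⁻¹ * (1 - r)⁻¹ * (1 + (α * ρ)⁻¹) * (1 - r)⁻¹ / R) := by
  have hn₁' : (1 : ℝ) ≤ Npool1 θ n := by exact_mod_cast hn₁
  have hlam : 0 < Nlam μ₁ μ₂ θ ρ n := by unfold Nlam; positivity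
  have hR' : (0 : ℝ) < R := by exact_mod_cast hR
  have h1r : 0 < 1 - r := by linarith
  have h1s : 0 < 1 - s := by linarith
  have h1ρ : 0 < 1 - ρ := by linarith
  have h1x : 0 < 1 - x := by linarith
  have hx0 : 0 < x := by linarith
  obtain ⟨hS0, hS1⟩ := boundary_sum_mem_Icc hμ₁ hμ₂ hα hlam hn hn₁ hρ hρ1 hs hs1 hE
  rw [NP, tsum_Nwt_eq, tsum_Nwt_boundary_eq]
  have ha₀ : (1 - r) * Nlam μ₁ μ₂ θ ρ n ≤ x * Npool1 θ n * μ₁ := by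
    have : x * (r * (α * Nlam μ₁ μ₂ θ ρ n)) ≤ 1 * (r * (1 * Nlam μ₁ μ₂ θ ρ n)) := by gcongr
    linarith
  set S0 := ∑ k ∈ Finset.range (Npool2 θ n + 1), ∑ j ∈ Finset.range (Npool2 θ n + 1),
    Nwt μ₁ μ₂ θ ρ α n (k, 0, j)
  set p := descWeight (Npool2 θ n) (μ₂ / (α * Nlam μ₁ μ₂ θ ρ n)) with hp
  set B : ℕ → ℝ := fun k => ∑ i ∈ Finset.range (Npool1 θ n),
    ∑ j ∈ Finset.range (Npool2 θ n + 1), Nwt μ₁ μ₂ θ ρ α n (k, i + 1, j)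
  have hp0 : ∀ k, 0 ≤ p k := descWeight_nonneg (by positivity)
  have hB0 : ∀ k, 0 ≤ B k := fun k => Finset.sum_nonneg fun i _ => Finset.sum_nonneg fun j _ =>
    Nwt_interior_nonneg hμ₁ hμ₂ hα hlam k i j
  have hM : 0 < (1 - r) * R := by positivity
  have hzero : p 0 ≤ ((1 - r) * R)⁻¹ * B 0 := by
    rw [← div_eq_inv_mul, le_div_iff₀ hM]
    refine descWeight_mul_le_interior_sum hμ₁ hμ₂ hα hlam hx0.le (Nat.zero_le _) hR₁ hR₂ ha₀ ?_
    rw [Nlam, Nat.sub_zero]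
    gcongr
  have hsucc : ∀ k < Npool2 θ n,
      p (k + 1) ≤ r * p k + (α * ρ)⁻¹ * ((1 - r) * R)⁻¹ * B k := by
    intro k hk
    have hcast : ((Npool2 θ n - k : ℕ) : ℝ) = (Npool2 θ n : ℝ) - k := Nat.cast_sub hk.le
    rw [hp, descWeight_succ hk.le, ← hp, ← hcast, mul_div_assoc']
    by_cases hsmall : ((Npool2 θ n - k : ℕ) : ℝ) * μ₂ ≤ r * (α * Nlam μ₁ μ₂ θ ρ n)
    · have h1 : ((Npool2 θ n - k : ℕ) : ℝ) * μ₂ / (α * Nlam μ₁ μ₂ θ ρ n) ≤ r := by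
        rwa [div_le_iff₀ (by positivity)]
      have h2 := mul_le_mul_of_nonneg_right h1 (hp0 k)
      have h3 : 0 ≤ (α * ρ)⁻¹ * ((1 - r) * R)⁻¹ * B k := mul_nonneg (by positivity) (hB0 k)
      linarith
    · push Not at hsmall
      have hpB : p k ≤ ((1 - r) * R)⁻¹ * B k := by
        rw [← div_eq_inv_mul, le_div_iff₀ hM]
        refine descWeight_mul_le_interior_sum hμ₁ hμ₂ hα hlam hx0.le hk.le hR₁ ?_ ha₀ ?_
        · have := mul_le_mul_of_nonneg_left hsmall.le h1x.le
          refine le_of_mul_le_mul_right ?_ hμ₂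
          linarith
        · refine hX.trans ?_
          gcongr
      have h1 : ((Npool2 θ n - k : ℕ) : ℝ) * μ₂ / (α * Nlam μ₁ μ₂ θ ρ n) ≤ (α * ρ)⁻¹ := by
        refine mul_div_lam_le hα hρ hlam ?_
        have h2 : ((Npool2 θ n - k : ℕ) : ℝ) ≤ Npool2 θ n := by exact_mod_cast Nat.sub_le _ _
        have h3 := mul_le_mul_of_nonneg_right h2 hμ₂.le
        have h4 : 0 ≤ (Npool1 θ n : ℝ) * μ₁ := by positivity
        linarith
      have h5 := mul_le_mul h1 hpB (hp0 k) (by positivity)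
      have h6 := mul_nonneg hr.le (hp0 k)
      rw [mul_assoc (α * ρ)⁻¹]
      linarith
  have hcontr := sum_le_of_contraction hp0 hB0 hr.le (by positivity) (by positivity) hzero hsucc
  set Sa := ∑ k ∈ Finset.range (Npool2 θ n + 1), B k
  set P := ∑ k ∈ Finset.range (Npool2 θ n + 1), p k
  have hSa : 0 ≤ Sa := Finset.sum_nonneg fun k _ => hB0 k
  have hP : P ≤ (1 - r)⁻¹ *
      ((((1 - r) * R)⁻¹ + (α * ρ)⁻¹ * ((1 - r) * R)⁻¹) * Sa) := by
    rw [← div_eq_inv_mul, le_div_iff₀ h1r, mul_comm]; exact hcontr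
  refine ⟨by positivity, div_le_of_le_mul₀ (by positivity) (by positivity) ?_⟩
  calc S0 ≤ ((α * ρ)⁻¹ + (1 - ρ)⁻¹) * (1 - s)⁻¹ * P := hS1
    _ ≤ ((α * ρ)⁻¹ + (1 - ρ)⁻¹) * (1 - s)⁻¹ * ((1 - r)⁻¹ *
      ((((1 - r) * R)⁻¹ + (α * ρ)⁻¹ * ((1 - r) * R)⁻¹) * Sa)) := by gcongr
    _ = (((α * ρ)⁻¹ + (1 - ρ)⁻¹) * (1 - s)⁻¹ * (1 - r)⁻¹ * (1 + (α * ρ)⁻¹) * (1 - r)⁻¹ / R) *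
      Sa := by field_simp
    _ ≤ _ := mul_le_mul_of_nonneg_left (by linarith) (by positivity)

/-- Theorem 3 (vanishing probability of no idle flexible servers): under
stability (`ρ < 1`, `δ < 1`) and complete resource pooling (`α + β > 1`), the
stationary probability that there are no idle pool-1 servers tends to `0` as
`n → ∞`. -/
theorem prob_no_idle_pool1_tendsto_zero
    (μ₁ μ₂ θ ρ α T f₁ f₂ β δ : ℝ)
    (hμ₁ : 0 < μ₁) (hμ₂ : 0 < μ₂)
    (hθ : θ ∈ Set.Ioo (0 : ℝ) 1) (hρ : ρ ∈ Set.Ioo (0 : ℝ) 1)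
    (hα : α ∈ Set.Ioc (0 : ℝ) 1)
    (hT : 0 < T)
    (hTroot : ρ * (θ * μ₁ + (1 - θ) * μ₂)
        = θ * (1 / μ₁ + T)⁻¹ + (1 - θ) * (1 / μ₂ + T)⁻¹)
    (hf₁ : f₁ = T * θ / (T + 1 / μ₁))
    (hf₂ : f₂ = T * (1 - θ) / (T + 1 / μ₂))
    (hβ : β = f₁ / (f₁ + f₂))
    (hδ : δ = (1 - α) * ρ * (θ * μ₁ + (1 - θ) * μ₂) / (θ * μ₁))
    (hδ1 : δ < 1)
    (hpool : 1 < α + β) :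
    Tendsto (fun n : ℕ => NP μ₁ μ₂ θ ρ α n {t : ℕ × ℕ × ℕ | t.2.1 = 0})
      atTop (nhds 0) := by

  obtain ⟨hθ0, hθ1⟩ := hθ
  obtain ⟨hρ0, hρ1⟩ := hρ
  obtain ⟨hα0, hα1⟩ := hα
  set L := ρ * (θ * μ₁ + (1 - θ) * μ₂) with hL
  have h1θ : 0 < 1 - θ := by linarith
  have hL0 : 0 < L := by positivity
  have hE0 : (1 - α) * L < θ * μ₁ := by
    rw [hδ, div_lt_one (by positivity)] at hδ1
    linarith
  obtain ⟨s, hs0, hs1, hs⟩ := exists_factor_lt_one (l := 0) (c := (1 - θ) * μ₂)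
    (a := θ * μ₁ - (1 - α) * L + (1 - θ) * μ₂) (b := 0) one_pos (by linarith)
  obtain ⟨r, hr0, hr1, hr⟩ := exists_factor_lt_one (l := 0) (c := L)
    (a := α * L) (b := θ * μ₁) one_pos (by linarith)
  obtain ⟨x, hxρ, hx1, hx⟩ := exists_factor_lt_one (c := L)
    (a := θ * μ₁ + r * (α * L)) (b := 0) hρ1 (by linarith)
  have h1x : 0 < 1 - x := by linarith
  set C := ((α * ρ)⁻¹ + (1 - ρ)⁻¹) * (1 - s)⁻¹ * (1 - r)⁻¹ * (1 + (α * ρ)⁻¹) * (1 - r)⁻¹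
  have hθ : θ ∈ Set.Ioo (0 : ℝ) 1 := ⟨hθ0, hθ1⟩
  have hev : ∀ R : ℕ, 0 < R → ∀ᶠ n in atTop,
      NP μ₁ μ₂ θ ρ α n {t : ℕ × ℕ × ℕ | t.2.1 = 0} ∈ Set.Icc 0 (C / R) := by
    intro R hR
    have t1 := (Npool_linear_tendsto (a := 1) (b := 0) hθ (by linarith)).eventually_ge_atTop 1
    have t2 := (Npool_linear_tendsto
      (a := s * (μ₁ - (1 - α) * (ρ * μ₁))) (b := s * (μ₂ - (1 - α) * (ρ * μ₂)) - μ₂) hθ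
      (by rw [hL] at hs; linarith)).eventually_ge_atTop μ₂
    have t3 := (Npool_linear_tendsto
      (a := x * (μ₁ + r * (α * (ρ * μ₁))) - ρ * μ₁)
      (b := x * (r * (α * (ρ * μ₂))) - ρ * μ₂) hθ
      (by rw [hL] at hx; linarith)).eventually_ge_atTop 0
    have t4 := (Npool_linear_tendsto (a := 1 - x) (b := 0) hθ
      (by simpa using mul_pos h1x hθ0)).eventually_ge_atTop (R : ℝ)
    have t5 := (Npool_linear_tendsto (a := 0) (b := 1 - x) hθ
      (by simpa using mul_pos h1x h1θ)).eventually_ge_atTop (R : ℝ)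
    have t6 := (Npool_linear_tendsto (a := (1 - x) * (r * (α * (ρ * μ₁))))
      (b := (1 - x) * (r * (α * (ρ * μ₂)))) hθ (by positivity)).eventually_ge_atTop (R * μ₂)
    filter_upwards [t1, t2, t3, t4, t5, t6] with n h1 h2 h3 h4 h5 h6
    have hn₁ : 1 ≤ Npool1 θ n := by
      have : (1 : ℝ) ≤ Npool1 θ n := by linarith
      exact_mod_cast this
    refine NP_no_idle_mem_Icc hμ₁ hμ₂ hα0 hα1 (Npool_add hθ n) hn₁ hρ0 hρ1 hs0 hs1 hr0 hr1
      hxρ hx1 hR ?_ ?_ ?_ ?_ ?_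
    · rw [Nlam]; linarith
    · rw [Nlam]; linarith
    · linarith
    · linarith
    · rw [Nlam]; linarith
  have hlim : Tendsto (fun R : ℕ => C / (R : ℝ)) atTop (nhds 0) :=
    tendsto_const_nhds.div_atTop tendsto_natCast_atTop_atTop
  rw [Metric.tendsto_atTop']
  intro ε hε
  obtain ⟨R, hRε, hR⟩ := ((hlim.eventually_lt_const hε).and (eventually_gt_atTop 0)).exists
  obtain ⟨N, hN⟩ := eventually_atTop.1 (hev R hR)
  refine ⟨N, fun n hn => ?_⟩
  obtain ⟨h0, h1⟩ := hN n hn.le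
  rw [Real.dist_eq, sub_zero, abs_of_nonneg h0]
  exact h1.trans_lt hRε
end

section
/- (Theorem 5: conditional fluid limit.) Under the setup below, with ρ < 1, δ < 1 and α + β > 1, for every fixed integer k ≥ 0 and every ε > 0: lim_{n→∞} P_n({(k,i₁,i₂) : |i₁ − m₁| ≥ εn or |i₂ − m₂| ≥ εn}) / P_n({(k,i₁,i₂) : all i₁,i₂}) = 0, where m₁ = T_n n₁/(T_n + 1/μ₁) and m₂ = T_n n₂/(T_n + 1/μ₂) and T_n is the unique positive root of 1 = (n₁/λ)(1/μ₁+T)^{−1} + (n₂/λ)(1/μ₂+T)^{−1}. -/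
open Filter

lemma factorial_mul_exp_le_pow (N : ℕ) :
    (N.factorial : ℝ) * Real.exp N ≤ ((N : ℝ) + 1) ^ (N + 1) := by
  induction N with
  | zero => simp
  | succ N ih =>
    have hN : (0 : ℝ) < (N : ℝ) + 1 := by positivity
    have hN2 : (0 : ℝ) < (N : ℝ) + 2 := by positivity
    have hstep : Real.exp 1 * ((N : ℝ) + 1) ^ (N + 2) ≤ ((N : ℝ) + 2) ^ (N + 2) := by
      have h1 : ((N : ℝ) + 1) / (N + 2) ≤ Real.exp (-(1 / ((N : ℝ) + 2))) := by
        have h := Real.add_one_le_exp (-(1 / ((N : ℝ) + 2)))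
        have e : ((N : ℝ) + 1) / (N + 2) = -(1 / ((N : ℝ) + 2)) + 1 := by field_simp; ring
        rwa [e]
      have h2 : (((N : ℝ) + 1) / (N + 2)) ^ (N + 2) ≤ Real.exp (-1) := by
        calc (((N : ℝ) + 1) / (N + 2)) ^ (N + 2)
            ≤ (Real.exp (-(1 / ((N : ℝ) + 2)))) ^ (N + 2) := by gcongr
          _ = Real.exp (-1) := by
            rw [← Real.exp_nat_mul]; congr 1; push_cast; field_simp
      rw [div_pow, div_le_iff₀ (by positivity)] at h2
      calc Real.exp 1 * ((N : ℝ) + 1) ^ (N + 2)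
          ≤ Real.exp 1 * (Real.exp (-1) * ((N : ℝ) + 2) ^ (N + 2)) := by gcongr
        _ = ((N : ℝ) + 2) ^ (N + 2) := by
          rw [← mul_assoc, ← Real.exp_add]; simp
    rw [Nat.factorial_succ]
    push_cast
    rw [Real.exp_add]
    calc ((N : ℝ) + 1) * N.factorial * (Real.exp N * Real.exp 1)
        = (Real.exp 1 * (N + 1)) * (N.factorial * Real.exp N) := by ring
      _ ≤ (Real.exp 1 * (N + 1)) * ((N : ℝ) + 1) ^ (N + 1) := by gcongr
      _ = Real.exp 1 * ((N : ℝ) + 1) ^ (N + 2) := by ring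
      _ ≤ ((N : ℝ) + 2) ^ (N + 2) := hstep
      _ = _ := by ring

lemma factorial_le_mul_pow_mul_exp_neg (N : ℕ) :
    (N.factorial : ℝ) ≤ Real.exp 1 * (N + 1) * N ^ N * Real.exp (-N) := by
  rw [Real.exp_neg, ← div_eq_mul_inv, le_div_iff₀ (Real.exp_pos _)]
  cases N with
  | zero => simp
  | succ N =>
    have h := factorial_mul_exp_le_pow N
    rw [Nat.factorial_succ]
    push_cast
    rw [Real.exp_add]
    calc ((N : ℝ) + 1) * N.factorial * (Real.exp N * Real.exp 1)
        = (Real.exp 1 * (N + 1)) * (N.factorial * Real.exp N) := by ring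
      _ ≤ (Real.exp 1 * (N + 1)) * ((N : ℝ) + 1) ^ (N + 1) := by gcongr
      _ ≤ (Real.exp 1 * (N + 1 + 1)) * ((N : ℝ) + 1) ^ (N + 1) := by gcongr; linarith

lemma pow_div_factorial_le_exp_tilt {c : ℝ} (hc : 0 ≤ c) (r : ℕ) {s : ℝ} (hs : |s| ≤ 1) :
    c ^ r / (r.factorial : ℝ) ≤ Real.exp (c + (s * (c - r) + c * s ^ 2)) := by
  have h1 : (c * Real.exp s) ^ r / (r.factorial : ℝ) ≤ Real.exp (c * Real.exp s) :=
    Real.pow_div_factorial_le_exp _ (by positivity) r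
  have h2 : Real.exp s ≤ 1 + s + s ^ 2 := by
    have := (abs_le.mp (Real.abs_exp_sub_one_sub_id_le hs)).2
    linarith
  rw [mul_pow, ← Real.exp_nat_mul] at h1
  have h3 : c ^ r / (r.factorial : ℝ) ≤ Real.exp (c * Real.exp s) * Real.exp (-(r * s)) := by
    rw [Real.exp_neg, ← div_eq_mul_inv, le_div_iff₀ (Real.exp_pos _)]
    calc _ = c ^ r * Real.exp (r * s) / r.factorial := by ring
      _ ≤ _ := h1
  refine h3.trans ?_
  rw [← Real.exp_add]
  apply Real.exp_le_exp.mpr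
  nlinarith [mul_le_mul_of_nonneg_left h2 hc]

lemma pow_div_factorial_le_exp_of_deviation {c ε n : ℝ} (hc : 0 ≤ c) (hcn : c ≤ n)
    (hε : 0 < ε) (hε1 : ε ≤ 1) (r : ℕ) (hr : ε * n ≤ |(r : ℝ) - c|) :
    c ^ r / (r.factorial : ℝ) ≤ Real.exp (c - ε ^ 2 / 4 * n) := by
  rcases le_abs'.mp hr with h | h
  · refine (pow_div_factorial_le_exp_tilt hc r (s := -(ε / 2)) ?_).trans ?_
    · rw [abs_neg, abs_of_pos (by positivity)]; linarith
    · apply Real.exp_le_exp.mpr; nlinarith [mul_le_mul_of_nonneg_right hcn (sq_nonneg ε)]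
  · refine (pow_div_factorial_le_exp_tilt hc r (s := ε / 2) ?_).trans ?_
    · rw [abs_of_pos (by positivity)]; linarith
    · apply Real.exp_le_exp.mpr; nlinarith [mul_le_mul_of_nonneg_right hcn (sq_nonneg ε)]

/-- The interior weights of the slice `K = k`, up to a factor depending only on the slice,
written in the shifted coordinates `a = i₁ - 1`, `b = i₂ - k`. -/
noncomputable def shiftedWeight (N₁ N₂ : ℕ) (x y : ℝ) (a b : ℕ) : ℝ :=
  (N₁.choose a : ℝ) * (N₂.choose b : ℝ) * ((a + b).factorial : ℝ) * x ^ a * y ^ b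

lemma shiftedWeight_nonneg (N₁ N₂ : ℕ) {x y : ℝ} (hx : 0 ≤ x) (hy : 0 ≤ y) (a b : ℕ) :
    0 ≤ shiftedWeight N₁ N₂ x y a b := by
  unfold shiftedWeight; positivity

/-- The total mass of the shifted weights over the box `a ≤ N₁`, `b ≤ N₂`. -/
noncomputable def shiftedTotal (N₁ N₂ : ℕ) (x y : ℝ) : ℝ :=
  ∑ p ∈ Finset.range (N₁ + 1) ×ˢ Finset.range (N₂ + 1), shiftedWeight N₁ N₂ x y p.1 p.2

lemma exp_mul_pow_mul_pow_le_shiftedTotal (N₁ N₂ : ℕ) {μ₁ μ₂ lam t : ℝ} (hμ₁ : 0 ≤ μ₁)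
    (hμ₂ : 0 ≤ μ₂) (hlam : 0 < lam) (ht : 0 ≤ t) :
    Real.exp (-(lam * t)) * (1 + μ₁ * t) ^ N₁ * (1 + μ₂ * t) ^ N₂
      ≤ shiftedTotal N₁ N₂ (μ₁ / lam) (μ₂ / lam) := by
  have h1 : ∀ (N : ℕ) (z : ℝ), (1 + z) ^ N =
      ∑ a ∈ Finset.range (N + 1), z ^ a * (N.choose a : ℝ) := by
    intro N z; rw [add_comm, add_pow]; simp
  rw [h1, h1, mul_assoc, Finset.sum_mul_sum, ← Finset.sum_product', Finset.mul_sum, shiftedTotal]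
  refine Finset.sum_le_sum fun p _ => ?_
  obtain ⟨a, b⟩ := p
  have h2 := Real.pow_div_factorial_le_exp (lam * t) (by positivity) (a + b)
  rw [div_le_iff₀ (by positivity)] at h2
  have h3 : Real.exp (-(lam * t)) * t ^ (a + b) ≤ (a + b).factorial / lam ^ (a + b) := by
    rw [Real.exp_neg, inv_mul_eq_div, div_le_div_iff₀ (Real.exp_pos _) (by positivity)]
    rw [mul_pow] at h2
    linarith
  unfold shiftedWeight
  calc Real.exp (-(lam * t)) * ((μ₁ * t) ^ a * (N₁.choose a : ℝ) * ((μ₂ * t) ^ b * N₂.choose b))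
      = (Real.exp (-(lam * t)) * t ^ (a + b)) *
          (N₁.choose a * N₂.choose b * μ₁ ^ a * μ₂ ^ b) := by ring
    _ ≤ ((a + b).factorial / lam ^ (a + b)) *
          (N₁.choose a * N₂.choose b * μ₁ ^ a * μ₂ ^ b) := by gcongr
    _ = _ := by rw [div_pow, div_pow, pow_add]; field_simp

lemma choose_mul_pow_mul_pow_le_one {p q : ℝ} (hp : 0 ≤ p) (hq : 0 ≤ q) (hpq : p + q = 1)
    (a b : ℕ) : ((a + b).choose a : ℝ) * p ^ a * q ^ b ≤ 1 := by
  have h := add_pow p q (a + b)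
  rw [hpq, one_pow] at h
  rw [h]
  have := Finset.single_le_sum (f := fun m => p ^ m * q ^ (a + b - m) * ((a + b).choose m : ℝ))
    (s := Finset.range (a + b + 1)) (fun i _ => by positivity)
    (Finset.mem_range.mpr (by omega : a < a + b + 1))
  refine le_trans (le_of_eq ?_) this
  simp only [Nat.add_sub_cancel_left]
  ring

lemma shiftedWeight_le_poisson {N₁ N₂ a b : ℕ} (ha : a ≤ N₁) (hb : b ≤ N₂)
    {μ₁ μ₂ lam c₁ c₂ : ℝ} (hμ₁ : 0 ≤ μ₁) (hμ₂ : 0 ≤ μ₂) (hlam : 0 < lam)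
    (hc₁ : 0 < c₁) (hc₂ : 0 < c₂) (hc : μ₁ * c₁ + μ₂ * c₂ = lam) :
    shiftedWeight N₁ N₂ (μ₁ / lam) (μ₂ / lam) a b ≤
      (N₁.factorial / c₁ ^ N₁) * (N₂.factorial / c₂ ^ N₂) *
        ((c₁ ^ (N₁ - a) / (N₁ - a).factorial) * (c₂ ^ (N₂ - b) / (N₂ - b).factorial)) := by
  obtain ⟨r, rfl⟩ := Nat.exists_eq_add_of_le ha
  obtain ⟨s, rfl⟩ := Nat.exists_eq_add_of_le hb
  have h1 := choose_mul_pow_mul_pow_le_one (p := μ₁ * c₁ / lam) (q := μ₂ * c₂ / lam)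
    (by positivity) (by positivity) (by rw [← add_div, hc, div_self hlam.ne']) a b
  simp only [Nat.add_sub_cancel_left]
  unfold shiftedWeight
  have e : ∀ i j : ℕ, ((i + j).choose i : ℝ) = (i + j).factorial / (i.factorial * j.factorial) := by
    intro i j
    rw [Nat.cast_choose ℝ (Nat.le_add_right i j), Nat.add_sub_cancel_left]
  rw [e] at h1
  rw [e, e]
  calc _ = ((a + r).factorial / c₁ ^ (a + r)) * ((b + s).factorial / c₂ ^ (b + s)) *
        (c₁ ^ r / r.factorial * (c₂ ^ s / s.factorial)) *
        ((a + b).factorial / (a.factorial * b.factorial) * (μ₁ * c₁ / lam) ^ a *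
          (μ₂ * c₂ / lam) ^ b) := by
        simp only [div_pow, mul_pow, pow_add]; field_simp
    _ ≤ ((a + r).factorial / c₁ ^ (a + r)) * ((b + s).factorial / c₂ ^ (b + s)) *
        (c₁ ^ r / r.factorial * (c₂ ^ s / s.factorial)) * 1 := by gcongr
    _ = _ := mul_one _

lemma factorial_div_pow_le {N n₁ : ℕ} (hN : N ≤ n₁) {c z : ℝ} (hc : 0 < c) (hz : n₁ / c = z) :
    (N.factorial / c ^ N : ℝ) ≤ Real.exp 1 * (N + 1) * z ^ N * Real.exp (-N) := by
  have h := factorial_le_mul_pow_mul_exp_neg N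
  have h2 : (N : ℝ) ^ N ≤ n₁ ^ N := by gcongr
  rw [← hz, div_pow, div_le_iff₀ (by positivity)]
  calc (N.factorial : ℝ) ≤ Real.exp 1 * (N + 1) * N ^ N * Real.exp (-N) := h
    _ ≤ Real.exp 1 * (N + 1) * n₁ ^ N * Real.exp (-N) := by gcongr
    _ = _ := by field_simp

lemma shiftedWeight_le_of_deviation {N₁ N₂ k a b : ℕ} (ha : a ≤ N₁) (hb : b ≤ N₂)
    {μ₁ μ₂ lam T ε n : ℝ} (hμ₁ : 0 < μ₁) (hμ₂ : 0 < μ₂) (hlam : 0 < lam) (hT : 0 < T)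
    (hN₂ : 0 < N₂) (hn : n = (N₁ + 1) + (N₂ + k))
    (hroot : μ₁ * ((N₁ + 1) / (1 + μ₁ * T)) + μ₂ * ((N₂ + k) / (1 + μ₂ * T)) = lam)
    (hε : 0 < ε) (hε1 : ε ≤ 1)
    (hdev : ε * n ≤ |((N₁ - a : ℕ) : ℝ) - (N₁ + 1) / (1 + μ₁ * T)| ∨
      ε * n ≤ |((N₂ - b : ℕ) : ℝ) - (N₂ + k) / (1 + μ₂ * T)|) :
    shiftedWeight N₁ N₂ (μ₁ / lam) (μ₂ / lam) a b ≤
      Real.exp (3 + k) * n ^ 2 * Real.exp (-(ε ^ 2 / 4 * n)) *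
        shiftedTotal N₁ N₂ (μ₁ / lam) (μ₂ / lam) := by
  set c₁ : ℝ := (N₁ + 1) / (1 + μ₁ * T) with hc₁
  set c₂ : ℝ := (N₂ + k) / (1 + μ₂ * T) with hc₂
  have hN₂' : (0 : ℝ) < N₂ := by exact_mod_cast hN₂
  have hz₁ : 1 < 1 + μ₁ * T := by have := mul_pos hμ₁ hT; linarith
  have hz₂ : 1 < 1 + μ₂ * T := by have := mul_pos hμ₂ hT; linarith
  have p₁ : 0 < c₁ := by positivity
  have p₂ : 0 < c₂ := by positivity
  have q₁ : c₁ ≤ N₁ + 1 := div_le_self (by positivity) hz₁.le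
  have q₂ : c₂ ≤ N₂ + k := div_le_self (by positivity) hz₂.le
  have hsum : c₁ + c₂ + lam * T = n := by
    rw [← hroot, hn]
    have e₁ : c₁ * (1 + μ₁ * T) = N₁ + 1 := by rw [hc₁]; field_simp
    have e₂ : c₂ * (1 + μ₂ * T) = N₂ + k := by rw [hc₂]; field_simp
    linarith
  have hpois : (c₁ ^ (N₁ - a) / (N₁ - a).factorial) * (c₂ ^ (N₂ - b) / (N₂ - b).factorial) ≤
      Real.exp (c₁ + c₂ - ε ^ 2 / 4 * n) := by
    rcases hdev with h | h
    · calc _ ≤ Real.exp (c₁ - ε ^ 2 / 4 * n) * Real.exp c₂ := by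
            gcongr
            · exact pow_div_factorial_le_exp_of_deviation p₁.le (by linarith) hε hε1 _ h
            · exact Real.pow_div_factorial_le_exp _ p₂.le _
        _ = _ := by rw [← Real.exp_add]; congr 1; ring
    · calc _ ≤ Real.exp c₁ * Real.exp (c₂ - ε ^ 2 / 4 * n) := by
            gcongr
            · exact Real.pow_div_factorial_le_exp _ p₁.le _
            · exact pow_div_factorial_le_exp_of_deviation p₂.le (by linarith) hε hε1 _ h
        _ = _ := by rw [← Real.exp_add]; congr 1; ring
  have f₁ := factorial_div_pow_le (N := N₁) (n₁ := N₁ + 1) (by omega) p₁ (z := 1 + μ₁ * T)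
    (by rw [hc₁]; push_cast; field_simp)
  have f₂ := factorial_div_pow_le (N := N₂) (n₁ := N₂ + k) (by omega) p₂ (z := 1 + μ₂ * T)
    (by rw [hc₂]; push_cast; field_simp)
  have hk : (0 : ℝ) ≤ k := by positivity
  have hN₁' : (0 : ℝ) ≤ N₁ := by positivity
  have g₁ : (N₁ : ℝ) + 1 ≤ n := by linarith
  have g₂ : (N₂ : ℝ) + 1 ≤ n := by linarith
  have hn0 : 0 < n := by linarith
  refine (shiftedWeight_le_poisson ha hb hμ₁.le hμ₂.le hlam p₁ p₂ hroot).trans ?_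
  calc _ ≤ (Real.exp 1 * (N₁ + 1) * (1 + μ₁ * T) ^ N₁ * Real.exp (-N₁)) *
        (Real.exp 1 * (N₂ + 1) * (1 + μ₂ * T) ^ N₂ * Real.exp (-N₂)) *
        Real.exp (c₁ + c₂ - ε ^ 2 / 4 * n) := by gcongr
    _ ≤ (Real.exp 1 * n * (1 + μ₁ * T) ^ N₁ * Real.exp (-N₁)) *
        (Real.exp 1 * n * (1 + μ₂ * T) ^ N₂ * Real.exp (-N₂)) *
        Real.exp (c₁ + c₂ - ε ^ 2 / 4 * n) := by gcongr
    _ = (Real.exp 1 * Real.exp 1 * Real.exp (-N₁) * Real.exp (-N₂) *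
          Real.exp (c₁ + c₂ - ε ^ 2 / 4 * n)) * n ^ 2 *
          ((1 + μ₁ * T) ^ N₁ * (1 + μ₂ * T) ^ N₂) := by ring
    _ = (Real.exp (3 + k) * Real.exp (-(ε ^ 2 / 4 * n)) * Real.exp (-(lam * T))) * n ^ 2 *
          ((1 + μ₁ * T) ^ N₁ * (1 + μ₂ * T) ^ N₂) := by
        simp only [← Real.exp_add]
        congr 3
        linarith
    _ = Real.exp (3 + k) * n ^ 2 * Real.exp (-(ε ^ 2 / 4 * n)) *
        (Real.exp (-(lam * T)) * (1 + μ₁ * T) ^ N₁ * (1 + μ₂ * T) ^ N₂) := by ring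
    _ ≤ _ := by
        gcongr
        exact exp_mul_pow_mul_pow_le_shiftedTotal N₁ N₂ hμ₁.le hμ₂.le hlam hT.le

lemma exp_div_one_add_le {z M : ℝ} (hz : 0 ≤ z) (hzM : z ≤ M) (N : ℕ) :
    Real.exp (N * z / (1 + M)) ≤ (1 + z) ^ N := by
  have h : Real.exp (z / (1 + M)) ≤ 1 + z := by
    have h1 : z / (1 + M) ≤ z / (1 + z) := by gcongr
    have h2 := Real.one_sub_inv_le_log_of_pos (show 0 < 1 + z by linarith)
    have h3 : z / (1 + z) = 1 - (1 + z)⁻¹ := by field_simp; ring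
    rw [← Real.le_log_iff_exp_le (by linarith)]
    linarith
  calc Real.exp (N * z / (1 + M)) = Real.exp (z / (1 + M)) ^ N := by
        rw [← Real.exp_nat_mul]; congr 1; ring
    _ ≤ _ := by gcongr

/-- Exponential growth of the interior mass in the underloaded regime. -/
lemma exp_le_shiftedTotal {N₁ N₂ k : ℕ} {μ₁ μ₂ ρ lam : ℝ} (hμ₁ : 0 < μ₁)
    (hμ₂ : 0 < μ₂) (hρ : 0 < ρ) (hρ1 : ρ < 1) (hlam : 0 < lam)
    (hl : lam = ρ * ((N₁ + 1) * μ₁ + (N₂ + k) * μ₂)) :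
    Real.exp ((1 - ρ) / ((1 + ρ) * (μ₁ + μ₂)) *
        ((1 - ρ) / 2 * (lam / ρ) - (k + 1) * (μ₁ + μ₂))) ≤
      shiftedTotal N₁ N₂ (μ₁ / lam) (μ₂ / lam) := by
  set t : ℝ := (1 - ρ) / ((1 + ρ) * (μ₁ + μ₂)) with ht
  have ht0 : 0 < t := div_pos (by linarith) (by positivity)
  have hM : 1 + (μ₁ + μ₂) * t = 2 / (1 + ρ) := by rw [ht]; field_simp; ring
  refine le_trans ?_ (exp_mul_pow_mul_pow_le_shiftedTotal N₁ N₂ hμ₁.le hμ₂.le hlam ht0.le)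
  have e₁ := exp_div_one_add_le (z := μ₁ * t) (M := (μ₁ + μ₂) * t) (by positivity)
    (by nlinarith [mul_pos hμ₂ ht0]) N₁
  have e₂ := exp_div_one_add_le (z := μ₂ * t) (M := (μ₁ + μ₂) * t) (by positivity)
    (by nlinarith [mul_pos hμ₁ ht0]) N₂
  refine le_trans ?_ (mul_le_mul (mul_le_mul_of_nonneg_left e₁ (Real.exp_pos _).le) e₂
    (Real.exp_pos _).le (by positivity))
  rw [← Real.exp_add, ← Real.exp_add, hM]
  apply Real.exp_le_exp.mpr
  have h1 : lam / ρ = (N₁ + 1) * μ₁ + (N₂ + k) * μ₂ := by rw [hl]; field_simp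
  have h2 : lam = ρ * (lam / ρ) := by field_simp
  have hk : (0 : ℝ) ≤ k := by positivity
  have h3 : (1 - ρ) / 2 * (lam / ρ) - (k + 1) * (μ₁ + μ₂) ≤
      -lam + (N₁ * μ₁ + N₂ * μ₂) * ((1 + ρ) / 2) := by
    have h4 : N₁ * μ₁ + N₂ * μ₂ = lam / ρ - (μ₁ + k * μ₂) := by rw [h1]; ring
    rw [h4]
    have h5 : (μ₁ + k * μ₂) * ((1 + ρ) / 2) ≤ (k + 1) * (μ₁ + μ₂) := by
      calc (μ₁ + k * μ₂) * ((1 + ρ) / 2) ≤ (μ₁ + k * μ₂) * 1 := by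
            gcongr; linarith
        _ ≤ _ := by nlinarith [mul_nonneg hk hμ₁.le]
    linarith
  calc _ ≤ t * (-lam + (N₁ * μ₁ + N₂ * μ₂) * ((1 + ρ) / 2)) := by gcongr
    _ = _ := by field_simp; ring

lemma tsum_slice_eq {f : ℕ × ℕ × ℕ → ℝ} {k N₁ N₂ : ℕ}
    (hf : ∀ i j, f (k, i, j) ≠ 0 →
      (∃ a ≤ N₁, ∃ b ≤ N₂, i = a + 1 ∧ j = b + k) ∨ (i = 0 ∧ j ≤ k))
    {E : Set (ℕ × ℕ × ℕ)} (hE : ∀ t ∈ E, t.1 = k) :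
    ∑' t : E, f t =
      ∑ p ∈ Finset.range (N₁ + 1) ×ˢ Finset.range (N₂ + 1), E.indicator f (k, p.1 + 1, p.2 + k) +
        ∑ j ∈ Finset.range (k + 1), E.indicator f (k, 0, j) := by
  classical
  set F := (Finset.range (N₁ + 1) ×ˢ Finset.range (N₂ + 1)).image
    (fun p : ℕ × ℕ => (k, p.1 + 1, p.2 + k)) with hF
  set G := (Finset.range (k + 1)).image (fun j : ℕ => (k, 0, j)) with hG
  have hdisj : Disjoint F G := by
    rw [Finset.disjoint_left]
    intro t h1 h2
    obtain ⟨p, _, rfl⟩ := Finset.mem_image.mp h1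
    obtain ⟨j, _, h⟩ := Finset.mem_image.mp h2
    simp at h
  rw [tsum_subtype E f, tsum_eq_sum (s := F ∪ G), Finset.sum_union hdisj, hF, hG,
    Finset.sum_image, Finset.sum_image]
  · intro i _ j _ h; simpa using h
  · rintro ⟨i, j⟩ _ ⟨i', j'⟩ _ h; simpa using h
  · rintro ⟨k', i, j⟩ ht
    by_contra h0
    have hmem := Set.mem_of_indicator_ne_zero h0
    obtain rfl : k' = k := hE _ hmem
    rw [Set.indicator_of_mem hmem] at h0
    apply ht
    rcases hf i j h0 with ⟨a, ha, b, hb, rfl, rfl⟩ | ⟨rfl, hj⟩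
    · refine Finset.mem_union_left _ (Finset.mem_image.mpr ⟨(a, b), ?_, rfl⟩)
      simp; omega
    · refine Finset.mem_union_right _ (Finset.mem_image.mpr ⟨j, ?_, rfl⟩)
      simp; omega

lemma Nwt_slice_support {μ₁ μ₂ θ ρ α : ℝ} {n k N₁ N₂ : ℕ} (h₁ : Npool1 θ n = N₁ + 1)
    (h₂ : Npool2 θ n = N₂ + k) (i j : ℕ) (h : Nwt μ₁ μ₂ θ ρ α n (k, i, j) ≠ 0) :
    (∃ a ≤ N₁, ∃ b ≤ N₂, i = a + 1 ∧ j = b + k) ∨ (i = 0 ∧ j ≤ k) := by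
  unfold Nwt at h
  simp only [h₁, h₂] at h
  split_ifs at h with h3 h4 h5
  · exact Or.inl ⟨i - 1, by omega, j - k, by omega, by omega, by omega⟩
  · exact Or.inr ⟨by omega, by omega⟩
  · exact Or.inr ⟨by omega, by omega⟩
  · exact absurd rfl h

lemma Nwt_interior {μ₁ μ₂ θ ρ α : ℝ} {n k N₁ N₂ a b : ℕ} (h₁ : Npool1 θ n = N₁ + 1)
    (h₂ : Npool2 θ n = N₂ + k) (ha : a ≤ N₁) (hb : b ≤ N₂) (hlam : Nlam μ₁ μ₂ θ ρ n ≠ 0)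
    (hα : α ≠ 0) :
    Nwt μ₁ μ₂ θ ρ α n (k, a + 1, b + k) =
      ((N₁ + 1) * ((N₂ + k).factorial / N₂.factorial) * (μ₁ / Nlam μ₁ μ₂ θ ρ n) *
        (μ₂ / Nlam μ₁ μ₂ θ ρ n) ^ k * (1 / α) ^ k) *
      shiftedWeight N₁ N₂ (μ₁ / Nlam μ₁ μ₂ θ ρ n) (μ₂ / Nlam μ₁ μ₂ θ ρ n) a b := by
  unfold Nwt shiftedWeight
  simp only [h₁, h₂]
  rw [if_pos (by omega)]
  set lam := Nlam μ₁ μ₂ θ ρ n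
  have e1 : ((N₁ + 1).choose (a + 1) : ℝ) * ((a + 1 : ℕ) : ℝ) = (N₁ + 1) * N₁.choose a := by
    have := Nat.add_one_mul_choose_eq N₁ a
    exact_mod_cast this.symm
  have e2 : ((N₂ + k).choose (b + k) : ℝ) * (((b + k).factorial : ℝ) / (b.factorial : ℝ)) =
      ((N₂ + k).factorial / N₂.factorial) * N₂.choose b := by
    rw [Nat.cast_choose ℝ (by omega : b + k ≤ N₂ + k), Nat.cast_choose ℝ hb,
      show N₂ + k - (b + k) = N₂ - b by omega]
    field_simp
  rw [show a + 1 + (b + k) - k - 1 = a + b by omega, Nat.add_sub_cancel]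
  have e3 : lam / (α * lam) = 1 / α := by field_simp
  rw [e3]
  calc _ = (((N₁ + 1).choose (a + 1) : ℝ) * ((a + 1 : ℕ) : ℝ)) *
        (((N₂ + k).choose (b + k) : ℝ) * (((b + k).factorial : ℝ) / (b.factorial : ℝ))) *
        ((a + b).factorial * μ₁ ^ (a + 1) * μ₂ ^ (b + k) * (lam ^ (a + 1 + (b + k)))⁻¹ *
          (1 / α) ^ k) := by ring
    _ = _ := by
      rw [e1, e2]
      simp only [div_pow, pow_add, pow_one]
      field_simp

lemma factorial_div_factorial_sub_le_pow {N k : ℕ} (hk : k ≤ N) :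
    (N.factorial : ℝ) / (N - k).factorial ≤ (N : ℝ) ^ k := by
  rw [div_le_iff₀ (by positivity)]
  have h := Nat.factorial_mul_descFactorial hk
  rw [← h]
  push_cast
  rw [mul_comm]
  gcongr
  exact_mod_cast Nat.descFactorial_le_pow N k

lemma Nwt_boundary {μ₁ μ₂ θ ρ α : ℝ} {n k j : ℕ} (hμ₁ : 0 < μ₁) (hμ₂ : 0 < μ₂)
    (hα : 0 < α)
    (h₁ : Npool1 θ n ≤ n) (h₂ : k ≤ Npool2 θ n) (hlam : 1 ≤ α * Nlam μ₁ μ₂ θ ρ n)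
    (hden : 1 ≤ μ₁ * (Npool1 θ n : ℝ) + μ₂ * ((Npool2 θ n : ℝ) - k) - Nlam μ₁ μ₂ θ ρ n) :
    0 ≤ Nwt μ₁ μ₂ θ ρ α n (k, 0, j) ∧
      Nwt μ₁ μ₂ θ ρ α n (k, 0, j) ≤ μ₁ * μ₂ ^ k * (n : ℝ) ^ (k + 1) := by
  have hn2 : (Npool2 θ n : ℝ) = n - Npool1 θ n := by
    unfold Npool2; rw [Nat.cast_sub h₁]
  have hn2le : Npool2 θ n ≤ n := Nat.sub_le _ _
  have hkn : k ≤ n := h₂.trans hn2le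
  set lam := Nlam μ₁ μ₂ θ ρ n with hlamdef
  have hlam0 : 0 < lam := by
    by_contra h
    nlinarith [not_lt.mp h]
  have hfac : ∀ i ∈ Finset.Icc (n - k) n,
      1 ≤ μ₁ * (Npool1 θ n : ℝ) + μ₂ * ((i : ℝ) - (Npool1 θ n : ℝ)) - (1 - α) * lam := by
    intro i hi
    have h1 : (n : ℝ) - k ≤ i := by
      rw [← Nat.cast_sub hkn]; exact_mod_cast (Finset.mem_Icc.mp hi).1
    have h2 : μ₂ * ((Npool2 θ n : ℝ) - k) ≤ μ₂ * ((i : ℝ) - (Npool1 θ n : ℝ)) :=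
      mul_le_mul_of_nonneg_left (by linarith) hμ₂.le
    nlinarith [mul_pos hα hlam0]
  have hprod : ∀ r ≤ n, 0 ≤ ∏ i ∈ Finset.Icc (n - k) r,
        (μ₁ * (Npool1 θ n : ℝ) + μ₂ * ((i : ℝ) - (Npool1 θ n : ℝ)) - (1 - α) * lam)⁻¹ ∧
      ∏ i ∈ Finset.Icc (n - k) r,
        (μ₁ * (Npool1 θ n : ℝ) + μ₂ * ((i : ℝ) - (Npool1 θ n : ℝ)) - (1 - α) * lam)⁻¹ ≤ 1 := by
    intro r hr
    have h0 : ∀ i ∈ Finset.Icc (n - k) r,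
        1 ≤ μ₁ * (Npool1 θ n : ℝ) + μ₂ * ((i : ℝ) - (Npool1 θ n : ℝ)) - (1 - α) * lam :=
      fun i hi => hfac i (Finset.Icc_subset_Icc_right hr hi)
    exact ⟨Finset.prod_nonneg fun i hi => inv_nonneg.mpr (by linarith [h0 i hi]),
      Finset.prod_le_one (fun i hi => inv_nonneg.mpr (by linarith [h0 i hi]))
        fun i hi => inv_le_one_of_one_le₀ (h0 i hi)⟩
  have hpre : (Npool1 θ n : ℝ) * ((Npool2 θ n).factorial / (Npool2 θ n - k).factorial) *
      μ₁ * μ₂ ^ k ≤ μ₁ * μ₂ ^ k * (n : ℝ) ^ (k + 1) := by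
    have h3 : ((Npool2 θ n).factorial : ℝ) / (Npool2 θ n - k).factorial ≤ (n : ℝ) ^ k :=
      (factorial_div_factorial_sub_le_pow h₂).trans (by gcongr)
    calc _ ≤ (n : ℝ) * (n : ℝ) ^ k * μ₁ * μ₂ ^ k := by gcongr
      _ = _ := by ring
  have key : ∀ x y : ℝ, 0 ≤ x → x ≤ 1 → 0 ≤ y → y ≤ 1 →
      0 ≤ (Npool1 θ n : ℝ) * ((Npool2 θ n).factorial / (Npool2 θ n - k).factorial) *
        μ₁ * μ₂ ^ k * x * y ∧
      (Npool1 θ n : ℝ) * ((Npool2 θ n).factorial / (Npool2 θ n - k).factorial) *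
        μ₁ * μ₂ ^ k * x * y ≤ μ₁ * μ₂ ^ k * (n : ℝ) ^ (k + 1) := by
    intro x y hx hx1 hy hy1
    refine ⟨by positivity, le_trans ?_ hpre⟩
    rw [mul_assoc _ x y]
    exact mul_le_of_le_one_right (by positivity) (mul_le_one₀ hx1 hy hy1)
  unfold Nwt
  simp only [← hlamdef]
  rw [if_neg (by omega)]
  split_ifs with h4 h5
  · exact key _ _ (by positivity) (inv_le_one_of_one_le₀ (one_le_pow₀ hlam))
      (hprod _ (Nat.sub_le _ _)).1 (hprod _ (Nat.sub_le _ _)).2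
  · have h6 : 1 ≤ μ₁ * (Npool1 θ n : ℝ) + μ₂ * (Npool2 θ n : ℝ) - lam := by
      have : 0 ≤ μ₂ * (k : ℝ) := by positivity
      linarith
    exact key _ _ (inv_nonneg.mpr (by linarith)) (inv_le_one_of_one_le₀ h6)
      (hprod _ (Nat.sub_le _ _)).1 (hprod _ (Nat.sub_le _ _)).2
  · exact ⟨le_rfl, by positivity⟩

lemma NP_div_NP_bounds {μ₁ μ₂ θ ρ α : ℝ} {n : ℕ} {E F : Set (ℕ × ℕ × ℕ)} {c : ℝ}
    (hE : 0 ≤ ∑' t : E, Nwt μ₁ μ₂ θ ρ α n t) (hF : 0 < ∑' t : F, Nwt μ₁ μ₂ θ ρ α n t)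
    (h : ∑' t : E, Nwt μ₁ μ₂ θ ρ α n t ≤ c * ∑' t : F, Nwt μ₁ μ₂ θ ρ α n t) :
    0 ≤ NP μ₁ μ₂ θ ρ α n E / NP μ₁ μ₂ θ ρ α n F ∧
      NP μ₁ μ₂ θ ρ α n E / NP μ₁ μ₂ θ ρ α n F ≤ c := by
  unfold NP
  rcases eq_or_ne (∑' t, Nwt μ₁ μ₂ θ ρ α n t) 0 with h0 | h0
  · simp only [h0, div_zero, le_refl, true_and]
    exact nonneg_of_mul_nonneg_left (hE.trans h) hF
  · rw [div_div_div_cancel_right₀ h0]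
    exact ⟨div_nonneg hE hF.le, (div_le_iff₀ hF).mpr h⟩

lemma conditional_deviation_le {μ₁ μ₂ θ ρ α T ε : ℝ} {n k N₁ N₂ : ℕ}
    (hμ₁ : 0 < μ₁) (hμ₂ : 0 < μ₂) (hρ : 0 < ρ) (hρ1 : ρ < 1) (hα : 0 < α) (hα1 : α ≤ 1)
    (h₁ : Npool1 θ n = N₁ + 1) (h₂ : Npool2 θ n = N₂ + k) (hN₂ : 0 < N₂)
    (hle : Npool1 θ n ≤ n) (hlam : 1 ≤ α * Nlam μ₁ μ₂ θ ρ n)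
    (hden : 1 ≤ μ₁ * (Npool1 θ n : ℝ) + μ₂ * ((Npool2 θ n : ℝ) - k) - Nlam μ₁ μ₂ θ ρ n)
    (hT : 0 < T)
    (hroot : 1 = ((Npool1 θ n : ℝ) / Nlam μ₁ μ₂ θ ρ n) * (1 / μ₁ + T)⁻¹
          + ((Npool2 θ n : ℝ) / Nlam μ₁ μ₂ θ ρ n) * (1 / μ₂ + T)⁻¹)
    (hε : 0 < ε) (hε1 : ε ≤ 1) {E : Set (ℕ × ℕ × ℕ)}
    (hE : ∀ t ∈ E, t.1 = k ∧
      (ε * n ≤ |(t.2.1 : ℝ) - T * (Npool1 θ n : ℝ) / (T + 1 / μ₁)| ∨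
        ε * n ≤ |(t.2.2 : ℝ) - T * (Npool2 θ n : ℝ) / (T + 1 / μ₂)|)) :
    0 ≤ NP μ₁ μ₂ θ ρ α n E / NP μ₁ μ₂ θ ρ α n {t | t.1 = k} ∧
      NP μ₁ μ₂ θ ρ α n E / NP μ₁ μ₂ θ ρ α n {t | t.1 = k} ≤
        Real.exp (3 + k) * (n : ℝ) ^ 4 * Real.exp (-(ε ^ 2 / 4 * n)) +
          (k + 1) * (μ₁ + μ₂) ^ (k + 1) * (n : ℝ) ^ (2 * k + 2) *
          Real.exp (-((1 - ρ) / ((1 + ρ) * (μ₁ + μ₂)) *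
            ((1 - ρ) / 2 * (Nlam μ₁ μ₂ θ ρ n / ρ) - (k + 1) * (μ₁ + μ₂)))) := by
  have hn : n = (N₁ + 1) + (N₂ + k) := by
    have h := h₂; unfold Npool2 at h; omega
  have hnR : (n : ℝ) = ((N₁ : ℝ) + 1) + (N₂ + k) := by exact_mod_cast hn
  have hc₁ : (Npool1 θ n : ℝ) = N₁ + 1 := by exact_mod_cast h₁
  have hc₂ : (Npool2 θ n : ℝ) = N₂ + k := by exact_mod_cast h₂
  have hbd := fun j => Nwt_boundary (j := j) hμ₁ hμ₂ hα hle (by omega) hlam hden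
  have hint := fun a b ha hb => Nwt_interior (μ₁ := μ₁) (μ₂ := μ₂) (ρ := ρ) (a := a) (b := b)
    h₁ h₂ ha hb (by rintro h; rw [h] at hlam; linarith) hα.ne'
  have hsupp := Nwt_slice_support (μ₁ := μ₁) (μ₂ := μ₂) (ρ := ρ) (α := α) h₁ h₂
  have hl : Nlam μ₁ μ₂ θ ρ n = ρ * ((N₁ + 1) * μ₁ + (N₂ + k) * μ₂) := by
    unfold Nlam; rw [hc₁, hc₂]
  rw [hc₁, hc₂] at hroot hE
  set lam := Nlam μ₁ μ₂ θ ρ n with hlamdef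
  set w := Nwt μ₁ μ₂ θ ρ α n with hw
  have hlam0 : 0 < lam := by rw [hl]; positivity
  have hlamn : lam ≤ (μ₁ + μ₂) * n := by
    rw [hl, hnR]
    have p1 : 0 ≤ ((N₁ : ℝ) + 1) * μ₂ := by positivity
    have p2 : 0 ≤ ((N₂ : ℝ) + k) * μ₁ := by positivity
    calc _ ≤ 1 * (((N₁ : ℝ) + 1) * μ₁ + (N₂ + k) * μ₂) := by gcongr
      _ ≤ _ := by linarith
  have hn1 : (1 : ℝ) ≤ n := by exact_mod_cast (by omega : 1 ≤ n)
  have hroot' : μ₁ * ((N₁ + 1) / (1 + μ₁ * T)) + μ₂ * ((N₂ + k) / (1 + μ₂ * T)) = lam := by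
    have e₁ : (1 / μ₁ + T)⁻¹ = μ₁ / (1 + μ₁ * T) := by field_simp
    have e₂ : (1 / μ₂ + T)⁻¹ = μ₂ / (1 + μ₂ * T) := by field_simp
    rw [e₁, e₂] at hroot
    calc _ = lam * (((N₁ : ℝ) + 1) / lam * (μ₁ / (1 + μ₁ * T)) +
          ((N₂ : ℝ) + k) / lam * (μ₂ / (1 + μ₂ * T))) := by field_simp
      _ = lam := by rw [← hroot, mul_one]
  set U := shiftedTotal N₁ N₂ (μ₁ / lam) (μ₂ / lam) with hU
  set A : ℝ := (N₁ + 1) * ((N₂ + k).factorial / N₂.factorial) * (μ₁ / lam) *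
        (μ₂ / lam) ^ k * (1 / α) ^ k with hA
  set g : ℝ := (1 - ρ) / ((1 + ρ) * (μ₁ + μ₂)) *
            ((1 - ρ) / 2 * (lam / ρ) - (k + 1) * (μ₁ + μ₂)) with hg
  have hUg : Real.exp g ≤ U := exp_le_shiftedTotal hμ₁ hμ₂ hρ hρ1 hlam0 hl
  have hU0 : 0 < U := (Real.exp_pos _).trans_le hUg
  have hA0 : 0 < A := by positivity
  have hAge : μ₁ * μ₂ ^ k ≤ A * ((μ₁ + μ₂) ^ (k + 1) * (n : ℝ) ^ (k + 1)) := by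
    have a1 : (1 : ℝ) ≤ N₁ + 1 := by linarith [Nat.cast_nonneg (α := ℝ) N₁]
    have a2 : (1 : ℝ) ≤ (N₂ + k).factorial / N₂.factorial := by
      rw [one_le_div (by positivity)]
      exact_mod_cast Nat.factorial_le (by omega)
    have a3 : (1 : ℝ) ≤ (1 / α) ^ k := one_le_pow₀ (by rw [le_div_iff₀ hα]; linarith)
    calc μ₁ * μ₂ ^ k = (1 * 1 * (μ₁ / lam) * (μ₂ / lam) ^ k * 1) * lam ^ (k + 1) := by
          rw [div_pow]; field_simp; ring
      _ ≤ A * ((μ₁ + μ₂) * n) ^ (k + 1) := by rw [hA]; gcongr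
      _ = _ := by rw [mul_pow]
  have hFsum : A * U ≤ ∑' t : {t : ℕ × ℕ × ℕ | t.1 = k}, w t := by
    rw [tsum_slice_eq (E := {t | t.1 = k}) hsupp (fun t ht => ht)]
    have s1 : ∑ p ∈ Finset.range (N₁ + 1) ×ˢ Finset.range (N₂ + 1),
        Set.indicator {t : ℕ × ℕ × ℕ | t.1 = k} w (k, p.1 + 1, p.2 + k) = A * U := by
      rw [hU, shiftedTotal, Finset.mul_sum]
      refine Finset.sum_congr rfl fun p hp => ?_
      simp only [Finset.mem_product, Finset.mem_range] at hp
      rw [Set.indicator_of_mem (by simp), hint _ _ (by omega) (by omega)]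
    have s2 : 0 ≤ ∑ j ∈ Finset.range (k + 1),
        Set.indicator {t : ℕ × ℕ × ℕ | t.1 = k} w (k, 0, j) := by
      refine Finset.sum_nonneg fun j _ => ?_
      rw [Set.indicator_of_mem (by simp)]
      exact (hbd j).1
    linarith
  have hAU : 0 < A * U := mul_pos hA0 hU0
  have hEeq := tsum_slice_eq hsupp (fun t ht => (hE t ht).1)
  have hEint : ∀ p ∈ Finset.range (N₁ + 1) ×ˢ Finset.range (N₂ + 1),
      0 ≤ E.indicator w (k, p.1 + 1, p.2 + k) ∧ E.indicator w (k, p.1 + 1, p.2 + k) ≤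
        A * (Real.exp (3 + k) * (n : ℝ) ^ 2 * Real.exp (-(ε ^ 2 / 4 * n)) * U) := by
    rintro ⟨a, b⟩ hp
    simp only [Finset.mem_product, Finset.mem_range] at hp
    have ha : a ≤ N₁ := by omega
    have hb : b ≤ N₂ := by omega
    by_cases hmem : (k, a + 1, b + k) ∈ E
    · simp only [Set.indicator_of_mem hmem]
      rw [hint a b ha hb]
      refine ⟨mul_nonneg hA0.le (shiftedWeight_nonneg _ _ (by positivity) (by positivity) _ _), ?_⟩
      refine mul_le_mul_of_nonneg_left ?_ hA0.le
      refine shiftedWeight_le_of_deviation ha hb hμ₁ hμ₂ hlam0 hT hN₂ hnR hroot' hε hε1 ?_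
      refine (hE _ hmem).2.imp (fun h => h.trans_eq ?_) (fun h => h.trans_eq ?_)
      · rw [← abs_neg]
        congr 1
        push_cast [Nat.cast_sub ha]
        field_simp
        ring
      · rw [← abs_neg]
        congr 1
        push_cast [Nat.cast_sub hb]
        field_simp
        ring
    · simp only [Set.indicator_of_notMem hmem]
      exact ⟨le_rfl, by positivity⟩
  have hEbd : ∀ j ∈ Finset.range (k + 1), 0 ≤ E.indicator w (k, 0, j) ∧
      E.indicator w (k, 0, j) ≤ μ₁ * μ₂ ^ k * (n : ℝ) ^ (k + 1) := by
    intro j _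
    by_cases hmem : (k, 0, j) ∈ E
    · rw [Set.indicator_of_mem hmem]; exact hbd j
    · rw [Set.indicator_of_notMem hmem]; exact ⟨le_rfl, by positivity⟩
  have hE0 : 0 ≤ ∑' t : E, w t := by
    rw [hEeq]
    exact add_nonneg (Finset.sum_nonneg fun p hp => (hEint p hp).1)
      (Finset.sum_nonneg fun j hj => (hEbd j hj).1)
  refine NP_div_NP_bounds hE0 (hAU.trans_le hFsum) ?_
  refine le_trans ?_ (mul_le_mul_of_nonneg_left hFsum (by positivity))
  rw [hEeq, add_mul]
  refine add_le_add ?_ ?_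
  · refine (Finset.sum_le_card_nsmul _ _ _ fun p hp => (hEint p hp).2).trans ?_
    rw [nsmul_eq_mul, Finset.card_product, Finset.card_range, Finset.card_range]
    have hcard : (((N₁ + 1) * (N₂ + 1) : ℕ) : ℝ) ≤ (n : ℝ) * n := by
      exact_mod_cast Nat.mul_le_mul (by omega : N₁ + 1 ≤ n) (by omega : N₂ + 1 ≤ n)
    calc _ ≤ ((n : ℝ) * n) *
          (A * (Real.exp (3 + k) * (n : ℝ) ^ 2 * Real.exp (-(ε ^ 2 / 4 * n)) * U)) := by gcongr
      _ = _ := by ring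
  · refine (Finset.sum_le_card_nsmul _ _ _ fun j hj => (hEbd j hj).2).trans ?_
    rw [nsmul_eq_mul, Finset.card_range]
    push_cast
    have hexp : 1 ≤ Real.exp (-g) * U := by
      rw [Real.exp_neg, inv_mul_eq_div, one_le_div (Real.exp_pos _)]; exact hUg
    calc ((k : ℝ) + 1) * (μ₁ * μ₂ ^ k * (n : ℝ) ^ (k + 1))
        ≤ ((k : ℝ) + 1) * (A * ((μ₁ + μ₂) ^ (k + 1) * (n : ℝ) ^ (k + 1)) * (n : ℝ) ^ (k + 1)) *
            1 := by rw [mul_one]; gcongr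
      _ ≤ ((k : ℝ) + 1) * (A * ((μ₁ + μ₂) ^ (k + 1) * (n : ℝ) ^ (k + 1)) * (n : ℝ) ^ (k + 1)) *
            (Real.exp (-g) * U) := by gcongr
      _ = _ := by ring

lemma tendsto_pow_mul_exp_neg_mul_nat (m : ℕ) {c : ℝ} (hc : 0 < c) :
    Tendsto (fun n : ℕ => (n : ℝ) ^ m * Real.exp (-(c * n))) atTop (nhds 0) := by
  have h := tendsto_pow_const_mul_const_pow_of_lt_one m (Real.exp_pos (-c)).le
    (Real.exp_lt_one_iff.mpr (by linarith))
  refine h.congr fun n => ?_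
  rw [← Real.exp_nat_mul]
  congr 2
  ring

/-- Theorem 5 (conditional fluid limit): under stability and complete resource
pooling, conditional on `K = k`, the scaled idle counts `(I₁/n, I₂/n)`
concentrate around the fluid means `(m₁/n, m₂/n)`: for every `ε > 0` the
conditional probability that `|I₁ - m₁| ≥ εn` or `|I₂ - m₂| ≥ εn` tends to 0. -/
theorem conditional_fluid_limit
    (μ₁ μ₂ θ ρ α T f₁ f₂ β δ : ℝ) (Tn : ℕ → ℝ)
    (hμ₁ : 0 < μ₁) (hμ₂ : 0 < μ₂)
    (hθ : θ ∈ Set.Ioo (0 : ℝ) 1) (hρ : ρ ∈ Set.Ioo (0 : ℝ) 1)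
    (hα : α ∈ Set.Ioc (0 : ℝ) 1)
    (hT : 0 < T)
    (hTroot : ρ * (θ * μ₁ + (1 - θ) * μ₂)
        = θ * (1 / μ₁ + T)⁻¹ + (1 - θ) * (1 / μ₂ + T)⁻¹)
    (hf₁ : f₁ = T * θ / (T + 1 / μ₁))
    (hf₂ : f₂ = T * (1 - θ) / (T + 1 / μ₂))
    (hβ : β = f₁ / (f₁ + f₂))
    (hδ : δ = (1 - α) * ρ * (θ * μ₁ + (1 - θ) * μ₂) / (θ * μ₁))
    (hδ1 : δ < 1)
    (hpool : 1 < α + β)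
    (hTn : ∀ n : ℕ, 2 ≤ n → 0 < Tn n)
    (hTnroot : ∀ n : ℕ, 2 ≤ n →
        1 = ((Npool1 θ n : ℝ) / Nlam μ₁ μ₂ θ ρ n) * (1 / μ₁ + Tn n)⁻¹
          + ((Npool2 θ n : ℝ) / Nlam μ₁ μ₂ θ ρ n) * (1 / μ₂ + Tn n)⁻¹)
    (m₁ m₂ : ℕ → ℝ)
    (hm₁ : ∀ n, m₁ n = Tn n * (Npool1 θ n : ℝ) / (Tn n + 1 / μ₁))
    (hm₂ : ∀ n, m₂ n = Tn n * (Npool2 θ n : ℝ) / (Tn n + 1 / μ₂)) :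
    ∀ k : ℕ, ∀ ε : ℝ, 0 < ε →
      Tendsto (fun n : ℕ =>
          NP μ₁ μ₂ θ ρ α n {t : ℕ × ℕ × ℕ | t.1 = k ∧
              (ε * n ≤ |(t.2.1 : ℝ) - m₁ n| ∨ ε * n ≤ |(t.2.2 : ℝ) - m₂ n|)} /
            NP μ₁ μ₂ θ ρ α n {t : ℕ × ℕ × ℕ | t.1 = k})
        atTop (nhds 0) := by
  intro k ε hε
  obtain ⟨hθ0, hθ1⟩ := hθ
  obtain ⟨hρ0, hρ1⟩ := hρ
  obtain ⟨hα0, hα1⟩ := hα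
  set ε' := min ε 1 with hε'
  have hε'0 : 0 < ε' := lt_min hε one_pos
  set c : ℝ := (1 - ρ) / ((1 + ρ) * (μ₁ + μ₂)) with hc
  have hc0 : 0 < c := div_pos (by linarith) (by positivity)
  set d : ℝ := c * ((1 - ρ) / 2 * (θ * μ₁)) with hd
  have hd0 : 0 < d := mul_pos hc0 (mul_pos (by linarith) (by positivity))
  have hlim : Tendsto (fun n : ℕ =>
      Real.exp (3 + k) * ((n : ℝ) ^ 4 * Real.exp (-(ε' ^ 2 / 4 * n))) +
        (k + 1) * (μ₁ + μ₂) ^ (k + 1) * Real.exp (c * ((k + 1) * (μ₁ + μ₂))) *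
          ((n : ℝ) ^ (2 * k + 2) * Real.exp (-(d * n)))) atTop (nhds 0) := by
    simpa using ((tendsto_pow_mul_exp_neg_mul_nat 4 (c := ε' ^ 2 / 4) (by positivity)).const_mul
      (Real.exp (3 + k))).add ((tendsto_pow_mul_exp_neg_mul_nat (2 * k + 2) hd0).const_mul
      ((k + 1) * (μ₁ + μ₂) ^ (k + 1) * Real.exp (c * ((k + 1) * (μ₁ + μ₂)))))
  have hlarge : ∀ C a : ℝ, 0 < a → ∀ᶠ n : ℕ in atTop, C ≤ a * n := fun C a ha =>
    (tendsto_natCast_atTop_atTop.const_mul_atTop ha).eventually_ge_atTop C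
  have hbounds : ∀ᶠ n : ℕ in atTop,
      0 ≤ NP μ₁ μ₂ θ ρ α n {t : ℕ × ℕ × ℕ | t.1 = k ∧
          (ε * n ≤ |(t.2.1 : ℝ) - m₁ n| ∨ ε * n ≤ |(t.2.2 : ℝ) - m₂ n|)} /
          NP μ₁ μ₂ θ ρ α n {t : ℕ × ℕ × ℕ | t.1 = k} ∧
      NP μ₁ μ₂ θ ρ α n {t : ℕ × ℕ × ℕ | t.1 = k ∧
          (ε * n ≤ |(t.2.1 : ℝ) - m₁ n| ∨ ε * n ≤ |(t.2.2 : ℝ) - m₂ n|)} /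
          NP μ₁ μ₂ θ ρ α n {t : ℕ × ℕ × ℕ | t.1 = k} ≤
        Real.exp (3 + k) * ((n : ℝ) ^ 4 * Real.exp (-(ε' ^ 2 / 4 * n))) +
        (k + 1) * (μ₁ + μ₂) ^ (k + 1) * Real.exp (c * ((k + 1) * (μ₁ + μ₂))) *
          ((n : ℝ) ^ (2 * k + 2) * Real.exp (-(d * n))) := by
    filter_upwards [eventually_ge_atTop 2, hlarge (k + 2) (1 - θ) (by linarith),
      hlarge 1 (α * (ρ * (θ * μ₁))) (by positivity),
      hlarge (1 + μ₂ * k) ((1 - ρ) * (θ * μ₁)) (mul_pos (by linarith) (by positivity))]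
      with n hn2 hn3 hn4 hn5
    have hnpos : (0 : ℝ) < n := by exact_mod_cast (by omega : 0 < n)
    have hp1 : θ * n ≤ (Npool1 θ n : ℝ) := Nat.le_ceil _
    have hp1' : (Npool1 θ n : ℝ) < θ * n + 1 := Nat.ceil_lt_add_one (by positivity)
    have hpos : 0 < Npool1 θ n := Nat.ceil_pos.mpr (by positivity)
    have hk : (0 : ℝ) ≤ k := by positivity
    have hsum : Npool1 θ n + (k + 1) ≤ n := by
      have : (Npool1 θ n : ℝ) + (k + 1) ≤ n := by linarith
      exact_mod_cast this
    have hp2 : k + 1 ≤ Npool2 θ n := by unfold Npool2; omega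
    have hlamge : θ * μ₁ * n ≤ Npool1 θ n * μ₁ + Npool2 θ n * μ₂ := by
      have : 0 ≤ (Npool2 θ n : ℝ) * μ₂ := by positivity
      nlinarith [mul_le_mul_of_nonneg_right hp1 hμ₁.le]
    have hlamdiv : Nlam μ₁ μ₂ θ ρ n / ρ = Npool1 θ n * μ₁ + Npool2 θ n * μ₂ := by
      unfold Nlam; field_simp
    have h := conditional_deviation_le (θ := θ) (α := α) (n := n) (k := k)
      (N₁ := Npool1 θ n - 1) (N₂ := Npool2 θ n - k)
      hμ₁ hμ₂ hρ0 hρ1 hα0 hα1 (by omega) (by omega) (by omega) (by omega)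
      (by
        unfold Nlam
        calc (1 : ℝ) ≤ α * (ρ * (θ * μ₁)) * n := hn4
          _ = α * (ρ * (θ * μ₁ * n)) := by ring
          _ ≤ _ := by gcongr)
      (by
        unfold Nlam
        have := mul_le_mul_of_nonneg_left hlamge (by linarith : 0 ≤ 1 - ρ)
        linarith)
      (hTn n hn2) (hTnroot n hn2) hε'0 (min_le_right _ _)
      (E := {t : ℕ × ℕ × ℕ | t.1 = k ∧
          (ε * n ≤ |(t.2.1 : ℝ) - m₁ n| ∨ ε * n ≤ |(t.2.2 : ℝ) - m₂ n|)})
      (by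
        rintro t ⟨ht, hdev⟩
        rw [← hm₁, ← hm₂]
        have hεn : ε' * n ≤ ε * n := by gcongr; exact min_le_left _ _
        exact ⟨ht, hdev.imp hεn.trans hεn.trans⟩)
    refine ⟨h.1, h.2.trans ?_⟩
    rw [hlamdiv, ← hc]
    have hexp : Real.exp (-(c * ((1 - ρ) / 2 * (Npool1 θ n * μ₁ + Npool2 θ n * μ₂) -
        (k + 1) * (μ₁ + μ₂)))) ≤
        Real.exp (c * ((k + 1) * (μ₁ + μ₂))) * Real.exp (-(d * n)) := by
      rw [← Real.exp_add]
      apply Real.exp_le_exp.mpr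
      have h2 : c * ((1 - ρ) / 2 * (θ * μ₁ * n)) ≤
          c * ((1 - ρ) / 2 * (Npool1 θ n * μ₁ + Npool2 θ n * μ₂)) := by
        gcongr
      rw [hd]
      linarith
    refine add_le_add (le_of_eq (by ring)) ?_
    calc _ ≤ (k + 1) * (μ₁ + μ₂) ^ (k + 1) * (n : ℝ) ^ (2 * k + 2) *
          (Real.exp (c * ((k + 1) * (μ₁ + μ₂))) * Real.exp (-(d * n))) := by gcongr
      _ = _ := by ring
  exact tendsto_of_tendsto_of_tendsto_of_le_of_le' tendsto_const_nhds hlim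
    (hbounds.mono fun _ h => h.1) (hbounds.mono fun _ h => h.2)
end
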